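/- arXiv:2512.21318 — 3 statements merged into one kernel-verified Lean document; each statement's English description precedes it below -/
import Mathlib

section
/- The independence complex of the cycle graph C_n on n ≥ 3 vertices is homotopy equivalent to: a wedge of two spheres S^{k-1} ∨ S^{k-1} if n = 3k; a sphere S^{k-1} if n = 3k+1; and a sphere S^k if n = 3k+2. -/
open Function Set

/-- A set of vertices of a simple graph is independent if its elements are
pairwise non-adjacent.  The independence complex `Ind G` is the simplicial
complex whose faces are exactly the independent sets. -/
def isIndepSet {V : Type*} (G : SimpleGraph V) (s : Set V) : Prop :=
  s.Pairwise fun a b => ¬ G.Adj a b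

/-- Geometric realization of the subcomplex of the independence complex of `G`
consisting of the independent sets contained in `S` (so `S = univ` gives
`Ind G`, `S = {v}ᶜ` gives `Ind (G \ v)`, and `S = N[v]ᶜ` gives
`Ind (G \ N[v])`): convex combinations of vertices whose support is a face. -/
def indRealizationIn {V : Type*} (G : SimpleGraph V) (S : Set V) : Set (V → ℝ) :=
  {f | (∀ v, 0 ≤ f v) ∧ (Function.support f).Finite ∧ Function.support f ⊆ S ∧
       isIndepSet G (Function.support f) ∧ ∑ᶠ v, f v = 1}

/-- Geometric realization of the independence complex `Ind G`. -/
def indRealization {V : Type*} (G : SimpleGraph V) : Set (V → ℝ) :=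
  indRealizationIn G Set.univ

/-- The (unreduced) suspension of a topological space. -/
def Susp (X : Type*) [TopologicalSpace X] : Type _ :=
  Quot (fun p q : X × unitInterval => (p.2 = 0 ∧ q.2 = 0) ∨ (p.2 = 1 ∧ q.2 = 1))

instance (X : Type*) [TopologicalSpace X] : TopologicalSpace (Susp X) :=
  inferInstanceAs (TopologicalSpace (Quot _))

/-- The wedge of two pointed topological spaces. -/
def WedgeAt (X Y : Type*) [TopologicalSpace X] [TopologicalSpace Y] (x₀ : X) (y₀ : Y) :
    Type _ :=
  Quot (fun p q : X ⊕ Y => p = Sum.inl x₀ ∧ q = Sum.inr y₀)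

instance (X Y : Type*) [TopologicalSpace X] [TopologicalSpace Y] (x₀ : X) (y₀ : Y) :
    TopologicalSpace (WedgeAt X Y x₀ y₀) :=
  inferInstanceAs (TopologicalSpace (Quot _))

/-- The sphere `S^{m-1}`, realized as the unit sphere of `ℝ^m`. -/
def sphere' (m : ℕ) : Set (EuclideanSpace ℝ (Fin m)) := Metric.sphere 0 1

/-- A wedge of two `m`-dimensional spheres: the two unit spheres of `ℝ^{m+1}`
centered at `±e₀`, which are tangent at the origin. -/
def sphereWedge (m : ℕ) : Set (EuclideanSpace ℝ (Fin (m + 1))) :=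
  {x | dist x (EuclideanSpace.single (0 : Fin (m + 1)) (1 : ℝ)) = 1 ∨
       dist x (-(EuclideanSpace.single (0 : Fin (m + 1)) (1 : ℝ))) = 1}

/-- The hexagonal line tiling graph `H_{1×1×n}`: two rows (row `j` carries the
vertices `v^{j+1}_1, …, v^{j+1}_{2n+1}`, column `i : Fin (2n+1)` being the
1-indexed vertex `v^{j+1}_{i+1}`), each row forming a path, together with the
rung edges `{v^1_{2t-1}, v^2_{2t-1}}`, i.e. rungs at even 0-indexed columns. -/
def hexRow (n : ℕ) : SimpleGraph (Fin 2 × Fin (2 * n + 1)) :=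
  SimpleGraph.fromRel (fun p q =>
    (p.1 = q.1 ∧ (p.2 : ℕ) + 1 = (q.2 : ℕ)) ∨
    (p.1 ≠ q.1 ∧ p.2 = q.2 ∧ (p.2 : ℕ) % 2 = 0))

/-- The last vertex `v^1_{2n+1}` of the top row of `H_{1×1×n}`. -/
def hexTop (n : ℕ) : Fin 2 × Fin (2 * n + 1) := (0, ⟨2 * n, by omega⟩)

/-- `X_n^{(1)} = H_{1×1×n} \ {v^1_{2n+1}}` : realization of its independence
complex, as the subcomplex of `Ind (H_{1×1×n})` of faces avoiding `v^1_{2n+1}`. -/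
def Xn1 (n : ℕ) : Set (Fin 2 × Fin (2 * n + 1) → ℝ) :=
  indRealizationIn (hexRow n) ({hexTop n}ᶜ)

/-- `X_n^{(2)} = H_{1×1×n} \ N[v^1_{2n+1}]` : realization of its independence
complex, as the subcomplex of `Ind (H_{1×1×n})` of faces avoiding `N[v^1_{2n+1}]`. -/
def Xn2 (n : ℕ) : Set (Fin 2 × Fin (2 * n + 1) → ℝ) :=
  indRealizationIn (hexRow n) ((insert (hexTop n) ((hexRow n).neighborSet (hexTop n)))ᶜ)



/-- Straight-line deformation retraction. -/
theorem retract_equiv {E : Type*} [NormedAddCommGroup E] [NormedSpace ℝ E] (X Y : Set E)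
    (hYX : Y ⊆ X) (r : X → E) (hr : Continuous r) (hrY : ∀ x, r x ∈ Y)
    (hfix : ∀ x : X, (x : E) ∈ Y → r x = x)
    (hseg : ∀ (x : X) (t : ℝ), 0 ≤ t → t ≤ 1 → (x : E) + t • (r x - x) ∈ X) :
    Nonempty (ContinuousMap.HomotopyEquiv X Y) := by
  let f : C(X, Y) := ⟨fun x => ⟨r x, hrY x⟩, by fun_prop⟩
  let g : C(Y, X) := ⟨fun y => ⟨y, hYX y.2⟩, by fun_prop⟩
  refine ⟨⟨f, g, ?_, ?_⟩⟩
  · refine ContinuousMap.Homotopic.symm ⟨⟨⟨fun p => ⟨(p.2 : E) + (p.1 : ℝ) • (r p.2 - p.2),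
      hseg p.2 p.1 p.1.2.1 p.1.2.2⟩, by fun_prop⟩, ?_, ?_⟩⟩
    · intro x; ext; simp
    · intro x; apply Subtype.ext; simp [f, g]
  · have : f.comp g = ContinuousMap.id _ := by
      ext1 y; exact Subtype.ext (hfix ⟨y, hYX y.2⟩ y.2)
    rw [this]

def HE (X Y : Type*) [TopologicalSpace X] [TopologicalSpace Y] : Prop :=
  Nonempty (ContinuousMap.HomotopyEquiv X Y)

theorem HE.symm {X Y : Type*} [TopologicalSpace X] [TopologicalSpace Y] (h : HE X Y) : HE Y X :=
  h.elim fun e => ⟨e.symm⟩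

theorem HE.trans {X Y Z : Type*} [TopologicalSpace X] [TopologicalSpace Y] [TopologicalSpace Z]
    (h : HE X Y) (h' : HE Y Z) : HE X Z :=
  h.elim fun e => h'.elim fun e' => ⟨e.trans e'⟩

theorem HE.of_eq {E : Type*} [TopologicalSpace E] {X Y : Set E} (h : X = Y) : HE X Y := by
  subst h; exact ⟨ContinuousMap.HomotopyEquiv.refl _⟩

def RR (n : ℕ) (rel : ℕ → ℕ → Prop) (S : ℕ → Prop) : Set (Fin n → ℝ) :=
  {f | (∀ v, 0 ≤ f v) ∧ (∀ v : Fin n, f v ≠ 0 → S v) ∧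
    (∀ a b : Fin n, f a ≠ 0 → f b ≠ 0 → ¬ rel a b) ∧ ∑ v, f v = 1}

theorem RR_congr {n : ℕ} {rel rel' : ℕ → ℕ → Prop} {S S' : ℕ → Prop}
    (hS : ∀ a, a < n → (S a ↔ S' a))
    (h : ∀ a b, a < n → b < n → S a → S b → (rel a b ↔ rel' a b)) :
    RR n rel S = RR n rel' S' := by
  ext f
  constructor
  · rintro ⟨h1, h2, h3, h4⟩
    refine ⟨h1, fun v hv => (hS v v.2).1 (h2 v hv), fun a b ha hb => ?_, h4⟩
    rw [← h a b a.2 b.2 (h2 a ha) (h2 b hb)]; exact h3 a b ha hb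
  · rintro ⟨h1, h2, h3, h4⟩
    have h2' := fun (v : Fin n) hv => (hS v v.2).2 (h2 v hv)
    refine ⟨h1, h2', fun a b ha hb => ?_, h4⟩
    rw [h a b a.2 b.2 (h2' a ha) (h2' b hb)]; exact h3 a b ha hb

theorem edge_move {n : ℕ} {rel rel' : ℕ → ℕ → Prop} {S : ℕ → Prop} (u v w : ℕ)
    (hu : u < n) (hv : v < n) (hw : w < n) (huv : u ≠ v) (huw : u ≠ w) (hvw : v ≠ w)
    (hSw : S w) (hww : ¬ rel w w)
    (hrel : ∀ a b, rel' a b ↔ rel a b ∨ (a = u ∧ b = v))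
    (hN : ∀ b, b < n → S b → (rel w b ∨ rel b w) →
      rel b u ∨ rel u b ∨ rel b v ∨ rel v b) :
    HE (RR n rel S) (RR n rel' S) := by
  let u' : Fin n := ⟨u, hu⟩
  let v' : Fin n := ⟨v, hv⟩
  let w' : Fin n := ⟨w, hw⟩
  have huv' : u' ≠ v' := by simpa [u', v'] using huv
  have huw' : u' ≠ w' := by simpa [u', w'] using huw
  have hvw' : v' ≠ w' := by simpa [v', w'] using hvw
  let d : Fin n → ℝ := fun z => (if z = w' then 2 else 0) - (if z = u' then 1 else 0) -
    (if z = v' then 1 else 0)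
  have hdsum : ∑ z, d z = 0 := by
    simp [d, Finset.sum_sub_distrib]; norm_num
  have hdu : d u' = -1 := by simp [d, huv', huw']
  have hdv : d v' = -1 := by simp [d, huv'.symm, hvw']
  have hdw : d w' = 2 := by simp [d, huw'.symm, hvw'.symm]
  have hdz : ∀ z, z ≠ u' → z ≠ v' → z ≠ w' → d z = 0 := by
    intro z h1 h2 h3; simp [d, h1, h2, h3]
  have key : ∀ f ∈ RR n rel S, ∀ s, 0 ≤ s → s ≤ min (f u') (f v') → f + s • d ∈ RR n rel S := by
    rintro f ⟨h1, h2, h3, h4⟩ s hs0 hs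
    have hsu : s ≤ f u' := hs.trans (min_le_left _ _)
    have hsv : s ≤ f v' := hs.trans (min_le_right _ _)
    have hval : ∀ z, (f + s • d) z = f z + s * d z := fun z => by simp
    have hnz : ∀ z, (f + s • d) z ≠ 0 → f z ≠ 0 ∨ (z = w' ∧ f u' ≠ 0 ∧ f v' ≠ 0) := by
      intro z hz
      by_contra hcon
      push Not at hcon
      obtain ⟨hfz, hcon⟩ := hcon
      apply hz
      rw [hval, hfz]
      by_cases hs' : s = 0
      · simp [hs']
      have hspos : 0 < s := lt_of_le_of_ne hs0 (Ne.symm hs')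
      by_cases hzw : z = w'
      · exact absurd (hcon hzw (by linarith)) (by linarith)
      · rw [hdz z _ _ hzw]
        · simp
        · rintro rfl; linarith
        · rintro rfl; linarith
    have hww2 : ∀ b : Fin n, f b ≠ 0 → f u' ≠ 0 → f v' ≠ 0 → ¬ (rel w b ∨ rel b w) := by
      intro b hb hu0 hv0 hcon
      rcases hN b b.2 (h2 b hb) hcon with h | h | h | h
      · exact h3 b u' hb hu0 h
      · exact h3 u' b hu0 hb h
      · exact h3 b v' hb hv0 h
      · exact h3 v' b hv0 hb h
    refine ⟨fun z => ?_, fun z hz => ?_, fun a b ha hb => ?_, ?_⟩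
    · rw [hval]
      by_cases hz1 : z = u'
      · subst hz1; rw [hdu]; linarith
      by_cases hz2 : z = v'
      · subst hz2; rw [hdv]; linarith
      by_cases hz3 : z = w'
      · subst hz3; rw [hdw]; linarith [h1 w']
      rw [hdz z hz1 hz2 hz3]; simpa using h1 z
    · rcases hnz z hz with h | ⟨rfl, -, -⟩
      · exact h2 z h
      · exact hSw
    · rcases hnz a ha with ha' | ⟨rfl, ha1, ha2⟩ <;> rcases hnz b hb with hb' | ⟨rfl, hb1, hb2⟩
      · exact h3 a b ha' hb'
      · exact fun h => hww2 a ha' hb1 hb2 (Or.inr h)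
      · exact fun h => hww2 b hb' ha1 ha2 (Or.inl h)
      · exact hww
    · simp only [hval]
      rw [Finset.sum_add_distrib, ← Finset.mul_sum, hdsum, h4]; simp
  refine retract_equiv _ _ ?_ (fun x => x.1 + (min (x.1 u') (x.1 v')) • d)
    (continuous_subtype_val.add ((((continuous_apply u').comp continuous_subtype_val).min
      ((continuous_apply v').comp continuous_subtype_val)).smul continuous_const)) ?_ ?_ ?_
  · rintro f ⟨h1, h2, h3, h4⟩
    exact ⟨h1, h2, fun a b ha hb h => h3 a b ha hb ((hrel _ _).2 (Or.inl h)), h4⟩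
  · rintro ⟨f, hf⟩
    obtain ⟨h1, h2, h3, h4⟩ := key f hf _ (le_min (hf.1 u') (hf.1 v')) le_rfl
    refine ⟨h1, h2, fun a b ha hb h => ?_, h4⟩
    rcases (hrel _ _).1 h with h | ⟨hau, hbv⟩
    · exact h3 a b ha hb h
    · have e1 : a = u' := Fin.ext hau
      have e2 : b = v' := Fin.ext hbv
      subst e1 e2
      simp only [Pi.add_apply, Pi.smul_apply, hdu, hdv, smul_eq_mul] at ha hb
      rcases min_choice (f u') (f v') with h | h
      · rw [h] at ha; apply ha; ring
      · rw [h] at hb; apply hb; ring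
  · rintro ⟨f, hf⟩ ⟨h1, h2, h3, h4⟩
    have : min (f u') (f v') = 0 := by
      have := h3 u' v'
      rw [hrel] at this
      rcases eq_or_ne (f u') 0 with h0 | h0
      · rw [h0]; exact min_eq_left (h1 v')
      rcases eq_or_ne (f v') 0 with h0' | h0'
      · rw [h0']; exact min_eq_right (h1 u')
      exact absurd (Or.inr ⟨rfl, rfl⟩) (this h0 h0')
    simp [this]
  · rintro ⟨f, hf⟩ t ht0 ht1
    have hm := le_min (hf.1 u') (hf.1 v')
    have := key f hf (t * min (f u') (f v')) (mul_nonneg ht0 hm) (by nlinarith)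
    simpa [smul_smul] using this

theorem fold_move {n : ℕ} {rel : ℕ → ℕ → Prop} {S : ℕ → Prop} (u v : ℕ)
    (hu : u < n) (hv : v < n) (huv : u ≠ v)
    (hSu : S u) (huu : ¬ rel u u)
    (hN : ∀ b, b < n → S b → (rel u b ∨ rel b u) → rel b v ∨ rel v b) :
    HE (RR n rel S) (RR n rel (fun a => S a ∧ a ≠ v)) := by
  let u' : Fin n := ⟨u, hu⟩
  let v' : Fin n := ⟨v, hv⟩
  have huv' : u' ≠ v' := by simpa [u', v'] using huv
  let d : Fin n → ℝ := fun z => (if z = u' then 1 else 0) - (if z = v' then 1 else 0)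
  have hdsum : ∑ z, d z = 0 := by
    simp [d, Finset.sum_sub_distrib]
  have hdu : d u' = 1 := by simp [d, huv']
  have hdv : d v' = -1 := by simp [d, huv'.symm]
  have hdz : ∀ z, z ≠ u' → z ≠ v' → d z = 0 := by
    intro z h1 h2; simp [d, h1, h2]
  have key : ∀ f ∈ RR n rel S, ∀ s, 0 ≤ s → s ≤ f v' → f + s • d ∈ RR n rel S := by
    rintro f ⟨h1, h2, h3, h4⟩ s hs0 hsv
    have hval : ∀ z, (f + s • d) z = f z + s * d z := fun z => by simp
    have hnz : ∀ z, (f + s • d) z ≠ 0 → f z ≠ 0 ∨ (z = u' ∧ f v' ≠ 0) := by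
      intro z hz
      by_contra hcon
      push Not at hcon
      obtain ⟨hfz, hcon⟩ := hcon
      apply hz
      rw [hval, hfz]
      by_cases hs' : s = 0
      · simp [hs']
      have hspos : 0 < s := lt_of_le_of_ne hs0 (Ne.symm hs')
      by_cases hzw : z = u'
      · exact absurd (hcon hzw) (by linarith)
      · rw [hdz z hzw]
        · simp
        · rintro rfl; linarith
    have hww2 : ∀ b : Fin n, f b ≠ 0 → f v' ≠ 0 → ¬ (rel u b ∨ rel b u) := by
      intro b hb hv0 hcon
      rcases hN b b.2 (h2 b hb) hcon with h | h
      · exact h3 b v' hb hv0 h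
      · exact h3 v' b hv0 hb h
    refine ⟨fun z => ?_, fun z hz => ?_, fun a b ha hb => ?_, ?_⟩
    · rw [hval]
      by_cases hz1 : z = u'
      · subst hz1; rw [hdu]; linarith [h1 u']
      by_cases hz2 : z = v'
      · subst hz2; rw [hdv]; linarith
      rw [hdz z hz1 hz2]; simpa using h1 z
    · rcases hnz z hz with h | ⟨rfl, -⟩
      · exact h2 z h
      · exact hSu
    · rcases hnz a ha with ha' | ⟨rfl, ha1⟩ <;> rcases hnz b hb with hb' | ⟨rfl, hb1⟩
      · exact h3 a b ha' hb'
      · exact fun h => hww2 a ha' hb1 (Or.inr h)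
      · exact fun h => hww2 b hb' ha1 (Or.inl h)
      · exact huu
    · simp only [hval]
      rw [Finset.sum_add_distrib, ← Finset.mul_sum, hdsum, h4]; simp
  refine retract_equiv _ _ ?_ (fun x => x.1 + (x.1 v') • d)
    (continuous_subtype_val.add (((continuous_apply v').comp continuous_subtype_val).smul
      continuous_const)) ?_ ?_ ?_
  · rintro f ⟨h1, h2, h3, h4⟩
    exact ⟨h1, fun z hz => (h2 z hz).1, h3, h4⟩
  · rintro ⟨f, hf⟩
    obtain ⟨h1, h2, h3, h4⟩ := key f hf _ (hf.1 v') le_rfl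
    refine ⟨h1, fun z hz => ⟨h2 z hz, ?_⟩, h3, h4⟩
    intro hzv
    have e1 : z = v' := Fin.ext hzv
    subst e1
    apply hz
    simp [hdv]
  · rintro ⟨f, hf⟩ ⟨h1, h2, h3, h4⟩
    have : f v' = 0 := by
      by_contra h0
      exact (h2 v' h0).2 rfl
    simp [this]
  · rintro ⟨f, hf⟩ t ht0 ht1
    have hm := hf.1 v'
    have := key f hf (t * f v') (mul_nonneg ht0 hm) (by nlinarith)
    simpa [smul_smul] using this

/-- cycle on `0..m-1` plus the disjoint edges `(m,m+1), (m+3,m+4), ...` -/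
def Rl (m a b : ℕ) : Prop :=
  (b = a + 1 ∧ b < m) ∨ (a = 0 ∧ b + 1 = m) ∨ (m ≤ a ∧ a % 3 = m % 3 ∧ b = a + 1)

def Sm (m a : ℕ) : Prop := a < m ∨ a % 3 ≠ (m + 2) % 3

theorem step (n m : ℕ) (hm : 2 ≤ m) (hmn : m + 3 ≤ n) :
    HE (RR n (Rl (m + 3)) (Sm (m + 3))) (RR n (Rl m) (Sm m)) := by
  let r2 : ℕ → ℕ → Prop := fun a b => (b = a + 1 ∧ b < m + 3 ∧ a + 1 ≠ m) ∨
    (a = 0 ∧ b = m + 2) ∨ (a = 0 ∧ b + 1 = m) ∨ (m + 3 ≤ a ∧ a % 3 = m % 3 ∧ b = a + 1)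
  let r1 : ℕ → ℕ → Prop := fun a b => Rl (m + 3) a b ∨ (a = 0 ∧ b = m - 1)
  have h1 : HE (RR n (Rl (m + 3)) (Sm (m + 3))) (RR n r1 (Sm (m + 3))) := by
    refine edge_move 0 (m - 1) (m + 1) (by omega) (by omega) (by omega) (by omega) (by omega)
      (by omega) ?_ ?_ ?_ ?_
    · unfold Sm; omega
    · unfold Rl; omega
    · intro a b; rfl
    · unfold Rl Sm; rintro b hb hS ((h | h | h) | (h | h | h)) <;> clear hS <;> omega
  have h2 : HE (RR n r2 (Sm (m + 3))) (RR n r1 (Sm (m + 3))) := by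
    refine edge_move (m - 1) m (m + 2) (by omega) (by omega) (by omega) (by omega) (by omega)
      (by omega) ?_ ?_ ?_ ?_
    · unfold Sm; omega
    · simp only [r2]; omega
    · intro a b; simp only [r1, r2, Rl]
      constructor
      · rintro ((h | h | h) | h) <;> omega
      · rintro ((h | h | h | h) | h) <;> omega
    · simp only [r2]
      intro b hb hS h
      have : b = m + 1 ∨ b = 0 := by
        clear hS
        rcases h with (h | h | h | h) | (h | h | h | h) <;> omega
      rcases this with this | this
      · exact Or.inr (Or.inr (Or.inr (Or.inl (by omega))))
      · exact Or.inl (Or.inr (Or.inr (Or.inl (by omega))))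
  have h3 : HE (RR n r2 (Sm (m + 3))) (RR n r2 (fun a => Sm (m + 3) a ∧ a ≠ m + 2)) := by
    refine fold_move m (m + 2) (by omega) (by omega) (by omega) ?_ ?_ ?_
    · unfold Sm; omega
    · simp only [r2]; omega
    · simp only [r2]; rintro b hb hS ((h | h | h | h) | (h | h | h | h)) <;> clear hS <;> omega
  refine (h1.trans h2.symm).trans (h3.trans (HE.of_eq (RR_congr ?_ ?_)))
  · intro a _; simp only [Sm]; omega
  · intro a b _ _; simp only [Sm, Rl, r2]
    intro ha hb
    constructor
    · rintro (h | h | h | h) <;> omega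
    · rintro (h | h | h) <;> omega

theorem steps (n m j : ℕ) (hm : 2 ≤ m) (hmn : m + 3 * j ≤ n) :
    HE (RR n (Rl (m + 3 * j)) (Sm (m + 3 * j))) (RR n (Rl m) (Sm m)) := by
  induction j with
  | zero => exact HE.of_eq rfl
  | succ j ih => exact (step n (m + 3 * j) (by omega) (by omega)).trans (ih (by omega))

theorem step4 (n : ℕ) (hn : 4 ≤ n) :
    HE (RR n (Rl 4) (Sm 4)) (RR n (Rl 4) (fun a => a % 3 ≠ 0)) := by
  have h3 : HE (RR n (Rl 4) (Sm 4)) (RR n (Rl 4) (fun a => Sm 4 a ∧ a ≠ 3)) := by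
    refine fold_move 1 3 (by omega) (by omega) (by omega) ?_ ?_ ?_
    · unfold Sm; omega
    · simp only [Rl]; omega
    · unfold Rl
      rintro b hb hS ((h | h | h) | (h | h | h)) <;> clear hS <;> omega
  have h4 : HE (RR n (Rl 4) (fun a => Sm 4 a ∧ a ≠ 3))
     (RR n (Rl 4) (fun a => (Sm 4 a ∧ a ≠ 3) ∧ a ≠ 0)) := by
    refine fold_move 2 0 (by omega) (by omega) (by omega) ?_ ?_ ?_
    · unfold Sm; omega
    · simp only [Rl]; omega
    · unfold Rl
      rintro b hb hS ((h | h | h) | (h | h | h)) <;> clear hS <;> omega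
  refine h3.trans (h4.trans (HE.of_eq (RR_congr ?_ ?_)))
  · intro a _; simp only [Sm]; omega
  · intros; rfl

theorem gauge_sphere {E : Type*} [NormedAddCommGroup E] [NormedSpace ℝ E] (G : E → ℝ)
    (hG : Continuous G) (hhom : ∀ (t : ℝ) x, 0 ≤ t → G (t • x) = t * G x)
    (hpos : ∀ x, x ≠ 0 → 0 < G x) : HE ({0}ᶜ : Set E) {x | G x = 1} := by
  have h0 : G 0 = 0 := by simpa using hhom 0 0 le_rfl
  refine retract_equiv _ _ ?_ (fun x => (G x.1)⁻¹ • x.1) ?_ ?_ ?_ ?_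
  · rintro x hx rfl; simp [h0] at hx
  · exact ((hG.comp continuous_subtype_val).inv₀ fun x => (hpos x.1 x.2).ne').smul
      continuous_subtype_val
  · rintro ⟨x, hx⟩
    have := hpos x hx
    simp only [mem_ofPred_eq]
    rw [hhom _ _ (by positivity)]; field_simp
  · rintro ⟨x, hx⟩ h
    simp only [mem_ofPred_eq] at h
    simp [h]
  · rintro ⟨x, hx⟩ t ht0 ht1
    have := hpos x hx
    have e : x + t • ((G x)⁻¹ • x - x) = ((1 - t) + t * (G x)⁻¹) • x := by module
    simp only [e, mem_compl_iff, mem_singleton_iff, smul_eq_zero, not_or]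
    refine ⟨?_, hx⟩
    have : 0 < (G x)⁻¹ := by positivity
    rcases ht0.eq_or_lt with rfl | h
    · norm_num
    · nlinarith [mul_pos h this]

theorem two_hole {E : Type*} [NormedAddCommGroup E] [NormedSpace ℝ E] (G : E → ℝ) (e : E)
    (φ : E → E)
    (hG : Continuous G) (hhom : ∀ (t : ℝ) x, 0 ≤ t → G (t • x) = t * G x)
    (hpos : ∀ x, x ≠ 0 → 0 < G x)
    (hboth : ∀ x, G (x - e) ≤ 1 → G (-x - e) ≤ 1 → G (x - e) = 1 ∧ G (-x - e) = 1)
    (hφ : Continuous φ)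
    (hφ1 : ∀ x, G (x - e) ≤ 1 → φ x = x) (hφ2 : ∀ x, G (-x - e) ≤ 1 → φ x = x)
    (hφ3 : ∀ x, 1 < G (x - e) → 1 < G (-x - e) → G (φ x - e) = 1 ∨ G (-φ x - e) = 1)
    (hφ4 : ∀ x (t : ℝ), 1 < G (x - e) → 1 < G (-x - e) → 0 ≤ t → t ≤ 1 →
      x + t • (φ x - x) ≠ e ∧ x + t • (φ x - x) ≠ -e) :
    HE ({x | x ≠ e ∧ x ≠ -e} : Set E) {x | G (x - e) = 1 ∨ G (-x - e) = 1} := by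
  classical
  have h0 : G 0 = 0 := by simpa using hhom 0 0 le_rfl
  have hposm : ∀ x, x ≠ -e → 0 < G (-x - e) := by
    intro x hx; apply hpos; intro h; apply hx
    have := sub_eq_zero.1 h; rw [← this]; simp
  have hposp : ∀ x, x ≠ e → 0 < G (x - e) := by
    intro x hx; apply hpos; exact sub_ne_zero.2 hx
  -- convex combination facts
  have hcoef : ∀ g t : ℝ, 0 < g → g ≤ 1 → 0 ≤ t → t ≤ 1 →
      0 < (1 - t) + t * g⁻¹ ∧ ((1 - t) + t * g⁻¹) * g ≤ 1 := by
    intro g t hg hg1 ht0 ht1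
    have h1 : 1 ≤ g⁻¹ := (one_le_inv₀ hg).2 hg1
    have h2 : g⁻¹ * g = 1 := by field_simp
    constructor <;> nlinarith
  let Bp : E → E := fun x => e + (G (x - e))⁻¹ • (x - e)
  let Bm : E → E := fun x => -e + (G (-x - e))⁻¹ • (x + e)
  let U : Set E := {x | x ≠ e ∧ x ≠ -e}
  have hp1 : ∀ x, G (x - e) = 1 → Bp x = x := by intro x h; simp [Bp, h]
  have hm1 : ∀ x, G (-x - e) = 1 → Bm x = x := by intro x h; simp [Bm, h]
  have cBp : Continuous (fun x : U => Bp x) := by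
    have : Continuous (fun x : U => G (x.1 - e)) := by fun_prop
    exact continuous_const.add ((this.inv₀ fun x => (hposp x.1 x.2.1).ne').smul (by fun_prop))
  have cBm : Continuous (fun x : U => Bm x) := by
    have : Continuous (fun x : U => G (-x.1 - e)) := by fun_prop
    exact continuous_const.add ((this.inv₀ fun x => (hposm x.1 x.2.2).ne').smul (by fun_prop))
  let r : U → E := fun x => if G (x.1 - e) ≤ 1 then Bp x else
    if G (-x.1 - e) ≤ 1 then Bm x else φ x
  have hfix : ∀ x : U, (G (x.1 - e) = 1 ∨ G (-x.1 - e) = 1) → r x = x := by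
    rintro ⟨x, hx⟩ h
    simp only [r]
    split_ifs with h1 h2
    · rcases h with h | h
      · exact hp1 x h
      · exact hp1 x (hboth x h1 h.le).1
    · rcases h with h | h
      · exact absurd h.le h1
      · exact hm1 x h
    · rcases h with h | h
      · exact absurd h.le h1
      · exact absurd h.le h2
  have hr : Continuous r := by
    refine Continuous.if_le cBp ?_ (by fun_prop) continuous_const ?_
    · refine Continuous.if_le cBm (by fun_prop) (by fun_prop) continuous_const ?_
      intro x hx
      rw [hm1 x hx, hφ2 x hx.le]
    · intro x hx
      rw [hp1 x hx]
      split_ifs with h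
      · rw [hm1 x (hboth x hx.le h).2]
      · rw [hφ1 x hx.le]
  refine retract_equiv U _ ?_ r hr ?_ hfix ?_
  · rintro x hx
    constructor
    · rintro rfl
      rcases hx with h | h
      · simp [h0] at h
      · have := hboth x (by simp [h0]) h.le
        simp [h0] at this
    · rintro rfl
      rcases hx with h | h
      · have := hboth (-e) h.le (by simp [h0])
        simp [h0] at this
      · simp [h0] at h
  · rintro ⟨x, hx⟩
    simp only [r]
    split_ifs with h1 h2
    · left
      have := hposp x hx.1
      simp only [Bp, add_sub_cancel_left]
      rw [hhom _ _ (by positivity)]; field_simp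
    · right
      have := hposm x hx.2
      have e1 : -Bm x - e = (G (-x - e))⁻¹ • (-x - e) := by simp only [Bm]; module
      rw [e1, hhom _ _ (by positivity)]; field_simp
    · exact hφ3 x (not_le.1 h1) (not_le.1 h2)
  · rintro ⟨x, hx⟩ t ht0 ht1
    simp only [r]
    split_ifs with h1 h2
    · have hg := hposp x hx.1
      obtain ⟨c1, c2⟩ := hcoef _ t hg h1 ht0 ht1
      set c := (1 - t) + t * (G (x - e))⁻¹ with hc
      have e1 : x + t • (Bp x - x) = e + c • (x - e) := by simp only [Bp, hc]; module
      rw [e1]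
      have hgy : G (e + c • (x - e) - e) = c * G (x - e) := by
        rw [add_sub_cancel_left, hhom _ _ c1.le]
      constructor
      · intro h
        rw [h] at hgy
        simp only [sub_self, h0] at hgy
        nlinarith [mul_pos c1 hg]
      · intro h
        rw [h] at hgy
        have := (hboth (-e) (hgy.trans_le c2) (by simp [h0])).2
        simp [h0] at this
    · have hg := hposm x hx.2
      obtain ⟨c1, c2⟩ := hcoef _ t hg h2 ht0 ht1
      set c := (1 - t) + t * (G (-x - e))⁻¹ with hc
      have e1 : x + t • (Bm x - x) = -e + c • (x + e) := by simp only [Bm, hc]; module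
      rw [e1]
      have hgy : G (-(-e + c • (x + e)) - e) = c * G (-x - e) := by
        rw [← hhom _ _ c1.le]; congr 1; module
      constructor
      · intro h
        rw [h] at hgy
        have := (hboth e (by simp [h0]) (hgy.trans_le c2)).1
        simp [h0] at this
      · intro h
        rw [h] at hgy
        simp only [neg_neg, sub_self, h0] at hgy
        nlinarith [mul_pos c1 hg]
    · exact hφ4 x t (not_le.1 h1) (not_le.1 h2) ht0 ht1

theorem hole_tangent (d : ℕ) :
    HE ({x | x ≠ EuclideanSpace.single 0 1 ∧ x ≠ -EuclideanSpace.single 0 1} :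
      Set (EuclideanSpace ℝ (Fin (d + 1)))) (sphereWedge d) := by
  set e : EuclideanSpace ℝ (Fin (d + 1)) := EuclideanSpace.single 0 1 with he
  have hn : ∀ x : EuclideanSpace ℝ (Fin (d + 1)), ‖x - e‖ ^ 2 = ‖x‖ ^ 2 - 2 * x 0 + 1 := by
    intro x
    rw [norm_sub_sq_real]
    simp [he, EuclideanSpace.inner_single_right]
  have hn' : ∀ x : EuclideanSpace ℝ (Fin (d + 1)), ‖-x - e‖ ^ 2 = ‖x‖ ^ 2 + 2 * x 0 + 1 := by
    intro x
    rw [hn]; simp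
  have sq1 : ∀ a : ℝ, 0 ≤ a → (a ≤ 1 ↔ a ^ 2 ≤ 1) := fun a ha => by
    constructor <;> intro h <;> nlinarith
  have sq2 : ∀ a : ℝ, 0 ≤ a → (a = 1 ↔ a ^ 2 = 1) := fun a ha => by
    constructor <;> intro h
    · simp [h]
    · nlinarith
  let c : EuclideanSpace ℝ (Fin (d + 1)) → ℝ := fun x => min 1 (2 * |x 0| / ‖x‖ ^ 2)
  have hc0 : ∀ x, 0 ≤ c x := fun x => le_min zero_le_one (by positivity)
  have hc1 : ∀ x, c x ≤ 1 := fun x => min_le_left _ _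
  have hcin : ∀ x, ‖x‖ ^ 2 ≤ 2 * |x 0| → c x • x = x := by
    intro x hx
    rcases eq_or_ne x 0 with rfl | h
    · simp
    have : 0 < ‖x‖ ^ 2 := by positivity
    have : c x = 1 := min_eq_left ((one_le_div this).2 hx)
    simp [this]
  have hcout : ∀ x, 2 * |x 0| < ‖x‖ ^ 2 → c x * ‖x‖ ^ 2 = 2 * |x 0| := by
    intro x hx
    have h : 0 < ‖x‖ ^ 2 := lt_of_le_of_lt (by positivity) hx
    have : c x = 2 * |x 0| / ‖x‖ ^ 2 := min_eq_right ((div_le_one h).2 hx.le)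
    rw [this, div_mul_cancel₀ _ h.ne']
  have hout : ∀ x, 1 < ‖x - e‖ → 1 < ‖-x - e‖ → 2 * |x 0| < ‖x‖ ^ 2 := by
    intro x h1 h2
    have a1 := hn x
    have a2 := hn' x
    rcases abs_cases (x 0) with ⟨h, _⟩ | ⟨h, _⟩ <;> rw [h] <;> nlinarith
  have hW : sphereWedge d = {x | ‖x - e‖ = 1 ∨ ‖-x - e‖ = 1} := by
    ext x
    simp only [sphereWedge, mem_ofPred_eq, dist_eq_norm]
    rw [show -x - e = -(x - -e) by abel, norm_neg]
  rw [hW]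
  refine two_hole (fun x => ‖x‖) e (fun x => c x • x) continuous_norm ?_ ?_ ?_ ?_ ?_ ?_ ?_ ?_
  · intro t x ht; simp [norm_smul, abs_of_nonneg ht]
  · intro x hx; simpa using hx
  · intro x h1 h2
    rw [sq1 _ (norm_nonneg _), hn] at h1
    rw [sq1 _ (norm_nonneg _), hn'] at h2
    rw [sq2 _ (norm_nonneg _), hn, sq2 _ (norm_nonneg _), hn']
    have := sq_nonneg ‖x‖
    have h3 : ‖x‖ ^ 2 = 0 := by linarith
    constructor <;> linarith
  · rw [continuous_iff_continuousAt]
    intro x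
    rcases eq_or_ne x 0 with rfl | h
    · have : ContinuousAt (fun x : EuclideanSpace ℝ (Fin (d + 1)) => c x • x) 0 ↔
        Filter.Tendsto (fun x : EuclideanSpace ℝ (Fin (d + 1)) => c x • x) (nhds 0) (nhds 0) := by
        simp [ContinuousAt]
      rw [this]
      refine squeeze_zero_norm (a := fun x => ‖x‖) ?_ ?_
      · intro x
        rw [norm_smul, Real.norm_of_nonneg (hc0 x)]
        exact mul_le_of_le_one_left (norm_nonneg _) (hc1 x)
      · exact tendsto_norm_zero
    · have h2 : ‖x‖ ^ 2 ≠ 0 := by positivity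
      refine ContinuousAt.smul (f := c) (g := fun x => x) ?_ continuousAt_id
      refine Filter.Tendsto.min (tendsto_const_nhds (x := (1 : ℝ))) ?_
      refine ContinuousAt.div ?_ ?_ h2 <;> fun_prop
  · intro x h1
    rw [sq1 _ (norm_nonneg _), hn] at h1
    exact hcin x (by linarith [le_abs_self (x 0)])
  · intro x h1
    rw [sq1 _ (norm_nonneg _), hn'] at h1
    exact hcin x (by linarith [neg_abs_le (x 0)])
  · intro x h1 h2
    have h3 := hcout x (hout x h1 h2)
    rw [sq2 _ (norm_nonneg _), hn, sq2 _ (norm_nonneg _), hn']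
    have e1 : ‖c x • x‖ ^ 2 = c x * (2 * |x 0|) := by
      rw [norm_smul, Real.norm_of_nonneg (hc0 x), ← h3]; ring
    have e2 : (c x • x) 0 = c x * x 0 := by simp
    rw [e1, e2]
    rcases abs_cases (x 0) with ⟨h, _⟩ | ⟨h, _⟩ <;> rw [h]
    · left; ring
    · right; ring
  · intro x t h1 h2 ht0 ht1
    have h3 := hcout x (hout x h1 h2)
    have h4 := hout x h1 h2
    have e1 : x + t • (c x • x - x) = (1 - t + t * c x) • x := by module
    rw [e1]
    set l := 1 - t + t * c x with hl
    have hlc : c x ≤ l := by nlinarith [hc1 x]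
    have hl0 : 0 ≤ l := (hc0 x).trans hlc
    have hlx : 2 * |x 0| ≤ l * ‖x‖ ^ 2 := by rw [← h3]; gcongr
    have k1 : ‖l • x‖ ^ 2 = l * (l * ‖x‖ ^ 2) := by
      rw [norm_smul, Real.norm_of_nonneg hl0]; ring
    have k2 : (l • x) 0 = l * x 0 := by simp
    have := mul_le_mul_of_nonneg_left hlx hl0
    have q1 := mul_le_mul_of_nonneg_left (le_abs_self (x 0)) hl0
    have q2 := mul_le_mul_of_nonneg_left (neg_abs_le (x 0)) hl0
    constructor
    · intro h
      have := hn (l • x)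
      rw [k1, k2, h] at this
      simp at this
      linarith
    · intro h
      have := hn' (l • x)
      rw [k1, k2, h] at this
      simp at this
      linarith

def N1 {k : ℕ} (x : EuclideanSpace ℝ (Fin k)) : ℝ := ∑ i, |x i|

theorem N1_cont {k : ℕ} : Continuous (N1 (k := k)) := by unfold N1; fun_prop

theorem N1_smul {k : ℕ} (t : ℝ) (ht : 0 ≤ t) (x : EuclideanSpace ℝ (Fin k)) :
    N1 (t • x) = t * N1 x := by
  simp [N1, abs_mul, abs_of_nonneg ht, Finset.mul_sum]

theorem N1_nonneg {k : ℕ} (x : EuclideanSpace ℝ (Fin k)) : 0 ≤ N1 x :=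
  Finset.sum_nonneg fun _ _ => abs_nonneg _

theorem N1_pos {k : ℕ} (x : EuclideanSpace ℝ (Fin k)) (hx : x ≠ 0) : 0 < N1 x := by
  refine lt_of_le_of_ne (N1_nonneg x) fun h => hx ?_
  have := (Finset.sum_eq_zero_iff_of_nonneg (fun i _ => abs_nonneg (x i))).1 h.symm
  ext i
  simpa using this i (Finset.mem_univ i)

theorem sphere_N1 (k : ℕ) : HE ({x | N1 x = 2} : Set (EuclideanSpace ℝ (Fin k))) (sphere' k) := by
  have h1 := gauge_sphere (E := EuclideanSpace ℝ (Fin k)) (fun x => N1 x / 2)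
    (N1_cont.div_const 2) (fun t x ht => by rw [N1_smul t ht]; ring)
    (fun x hx => by have := N1_pos x hx; positivity)
  have h2 := gauge_sphere (E := EuclideanSpace ℝ (Fin k)) (fun x => ‖x‖)
    continuous_norm (fun t x ht => by simp [norm_smul, abs_of_nonneg ht])
    (fun x hx => by simpa using hx)
  refine HE.trans (HE.of_eq ?_) (h1.symm.trans (h2.trans (HE.of_eq ?_)))
  · ext x; simp only [mem_ofPred_eq]; constructor <;> intro h <;> linarith
  · ext x; simp [sphere']

def Theta (k : ℕ) (Z : Set (Fin k)) : Set (EuclideanSpace ℝ (Fin k)) :=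
  {y | N1 y ≤ 2 ∧ (N1 y = 2 ∨ ∃ i ∈ Z, y i = 0)}

theorem hole_theta (d : ℕ) :
    HE ({x | x ≠ EuclideanSpace.single 0 1 ∧ x ≠ -EuclideanSpace.single 0 1} :
      Set (EuclideanSpace ℝ (Fin (d + 1)))) (Theta (d + 1) {0}) := by
  set e : EuclideanSpace ℝ (Fin (d + 1)) := EuclideanSpace.single 0 1 with he
  let T : EuclideanSpace ℝ (Fin (d + 1)) → ℝ := fun x => ∑ i : Fin d, |x i.succ|
  have hT0 : ∀ x, 0 ≤ T x := fun x => Finset.sum_nonneg fun _ _ => abs_nonneg _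
  have hNT : ∀ x, N1 x = |x 0| + T x := fun x => Fin.sum_univ_succ _
  have hTe : ∀ x, T (x - e) = T x := by intro x; simp [T, he]
  have hTneg : ∀ x, T (-x) = T x := by intro x; simp [T]
  have he0 : e 0 = 1 := by simp [he]
  have hNe : N1 e = 1 := by rw [hNT]; simp [T, he]
  have hNe' : N1 (-e) = 1 := by rw [← hNe]; simp [N1]
  let G : EuclideanSpace ℝ (Fin (d + 1)) → ℝ := fun x => max (-x 0) (x 0 + T x)
  have hGp : ∀ x, G (x - e) = max (1 - x 0) (x 0 - 1 + T x) := by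
    intro x; simp only [G, hTe]; simp [he0]
  have hGm : ∀ x, G (-x - e) = max (1 + x 0) (-x 0 - 1 + T x) := by
    intro x; rw [hGp, hTneg]; simp
  have hGc : Continuous G := by simp only [G, T]; fun_prop
  let c : EuclideanSpace ℝ (Fin (d + 1)) → ℝ := fun x => 2 / max (N1 x) 2
  have hcc : Continuous c := by
    refine continuous_const.div (N1_cont.max continuous_const) fun x => ?_
    have : (2:ℝ) ≤ max (N1 x) 2 := le_max_right _ _
    positivity
  have hcin : ∀ x, N1 x ≤ 2 → c x • x = x := by
    intro x hx; simp [c, max_eq_right hx]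
  have hpin : ∀ x, G (x - e) ≤ 1 ↔ (0 ≤ x 0 ∧ N1 x ≤ 2) := by
    intro x; rw [hGp, hNT, max_le_iff]
    constructor
    · rintro ⟨h1, h2⟩
      have : 0 ≤ x 0 := by linarith
      rw [abs_of_nonneg this]; constructor <;> linarith
    · rintro ⟨h1, h2⟩
      rw [abs_of_nonneg h1] at h2; constructor <;> linarith
  have hmin : ∀ x, G (-x - e) ≤ 1 ↔ (x 0 ≤ 0 ∧ N1 x ≤ 2) := by
    intro x; rw [hGm, hNT, max_le_iff]
    constructor
    · rintro ⟨h1, h2⟩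
      have : x 0 ≤ 0 := by linarith
      rw [abs_of_nonpos this]; constructor <;> linarith
    · rintro ⟨h1, h2⟩
      rw [abs_of_nonpos h1] at h2; constructor <;> linarith
  have hpeq : ∀ x, G (x - e) = 1 ↔ (0 ≤ x 0 ∧ N1 x ≤ 2 ∧ (x 0 = 0 ∨ N1 x = 2)) := by
    intro x
    constructor
    · intro h
      obtain ⟨h1, h2⟩ := (hpin x).1 h.le
      refine ⟨h1, h2, ?_⟩
      rw [hGp] at h
      rw [hNT, abs_of_nonneg h1]
      rcases max_choice (1 - x 0) (x 0 - 1 + T x) with h' | h' <;> rw [h'] at h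
      · left; linarith
      · right; linarith
    · rintro ⟨h1, h2, h3⟩
      refine le_antisymm ((hpin x).2 ⟨h1, h2⟩) ?_
      rw [hGp, le_max_iff]
      rw [hNT, abs_of_nonneg h1] at h3
      rcases h3 with h3 | h3
      · left; linarith
      · right; linarith
  have hmeq : ∀ x, G (-x - e) = 1 ↔ (x 0 ≤ 0 ∧ N1 x ≤ 2 ∧ (x 0 = 0 ∨ N1 x = 2)) := by
    intro x
    have hN : N1 (-x) = N1 x := by simp [N1]
    rw [hpeq, hN]; simp
  have hset : Theta (d + 1) {0} = {x | G (x - e) = 1 ∨ G (-x - e) = 1} := by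
    ext x
    simp only [Theta, mem_ofPred_eq, mem_singleton_iff, exists_eq_left]
    rw [hpeq, hmeq]
    have := le_total 0 (x 0)
    tauto
  have hout : ∀ x, 1 < G (x - e) → 1 < G (-x - e) → 2 < N1 x := by
    intro x h1 h2
    by_contra hcon
    rcases le_total 0 (x 0) with h | h
    · exact absurd ((hpin x).2 ⟨h, not_lt.1 hcon⟩) (not_le.2 h1)
    · exact absurd ((hmin x).2 ⟨h, not_lt.1 hcon⟩) (not_le.2 h2)
  have hcout : ∀ x, 2 < N1 x → c x * N1 x = 2 := by
    intro x hx
    simp only [c, max_eq_left hx.le]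
    field_simp
  have hc0 : ∀ x, 0 ≤ c x := fun x => by
    have : (2:ℝ) ≤ max (N1 x) 2 := le_max_right _ _
    positivity
  have hc1 : ∀ x, c x ≤ 1 := fun x => by
    have : (2:ℝ) ≤ max (N1 x) 2 := le_max_right _ _
    exact (div_le_one (by linarith)).2 this
  rw [hset]
  refine two_hole G e (fun x => c x • x) hGc ?_ ?_ ?_ (hcc.smul continuous_id) ?_ ?_ ?_ ?_
  · intro t x ht
    have : T (t • x) = t * T x := by simp [T, abs_mul, abs_of_nonneg ht, Finset.mul_sum]
    simp only [G]
    rw [mul_max_of_nonneg _ _ ht, this]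
    simp [mul_add]
  · intro x hx
    have h := N1_pos x hx
    rw [hNT] at h
    simp only [G, lt_max_iff]
    by_contra hcon
    push Not at hcon
    have h3 : 0 ≤ x 0 := by linarith
    rw [abs_of_nonneg h3] at h
    linarith
  · intro x h1 h2
    rw [hpin] at h1
    rw [hmin] at h2
    have : x 0 = 0 := le_antisymm h2.1 h1.1
    rw [hpeq, hmeq]
    exact ⟨⟨h1.1, h1.2, Or.inl this⟩, h2.1, h1.2, Or.inl this⟩
  · intro x h; exact hcin x ((hpin x).1 h).2
  · intro x h; exact hcin x ((hmin x).1 h).2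
  · intro x h1 h2
    have h3 : N1 (c x • x) = 2 := by rw [N1_smul _ (hc0 x)]; exact hcout x (hout x h1 h2)
    rw [hpeq, hmeq, h3]
    rcases le_total 0 ((c x • x) 0) with h | h
    · left; exact ⟨h, le_rfl, Or.inr rfl⟩
    · right; exact ⟨h, le_rfl, Or.inr rfl⟩
  · intro x t h1 h2 ht0 ht1
    have h4 := hout x h1 h2
    have h3 := hcout x h4
    have e1 : x + t • (c x • x - x) = (1 - t + t * c x) • x := by module
    rw [e1]
    set l := 1 - t + t * c x with hl
    have hlc : c x ≤ l := by nlinarith [hc1 x]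
    have hl0 : 0 ≤ l := (hc0 x).trans hlc
    have h5 : 2 ≤ N1 (l • x) := by rw [N1_smul _ hl0, ← h3]; gcongr
    constructor
    · intro h; rw [h, hNe] at h5; norm_num at h5
    · intro h; rw [h, hNe'] at h5; norm_num at h5

theorem RR_theta (n k : ℕ) (e : Option (Fin k ⊕ Fin k) → Fin n) (he : Injective e)
    (Z : Set (Fin k)) (R : Set (Fin n → ℝ))
    (hR : ∀ f, f ∈ R ↔ (∀ v, 0 ≤ f v) ∧ (∀ v, v ∉ range e → f v = 0) ∧
      (∀ i, f (e (some (Sum.inl i))) = 0 ∨ f (e (some (Sum.inr i))) = 0) ∧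
      (f (e none) = 0 ∨ ∃ i ∈ Z, f (e (some (Sum.inl i))) = 0 ∧ f (e (some (Sum.inr i))) = 0) ∧
      ∑ v, f v = 1) : HE R (Theta k Z) := by
  have hsum : ∀ f : Fin n → ℝ, (∀ v, v ∉ range e → f v = 0) → ∑ v, f v =
      f (e none) + ∑ i, (f (e (some (Sum.inl i))) + f (e (some (Sum.inr i)))) := by
    intro f hf
    rw [← Fintype.sum_of_injective e he (fun j => f (e j)) f hf (fun _ => rfl)]
    rw [Fintype.sum_option, Fintype.sum_sum_type, Finset.sum_add_distrib]
  let Y : (Fin n → ℝ) → EuclideanSpace ℝ (Fin k) := fun f =>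
    WithLp.toLp 2 (fun i => 2 * (f (e (some (Sum.inl i))) - f (e (some (Sum.inr i)))))
  have hYi : ∀ f i, Y f i = 2 * (f (e (some (Sum.inl i))) - f (e (some (Sum.inr i)))) :=
    fun f i => rfl
  let vals : EuclideanSpace ℝ (Fin k) → Option (Fin k ⊕ Fin k) → ℝ := fun y j =>
    match j with
    | none => 1 - N1 y / 2
    | some (Sum.inl i) => max (y i) 0 / 2
    | some (Sum.inr i) => max (-y i) 0 / 2
  let g : EuclideanSpace ℝ (Fin k) → Fin n → ℝ := fun y => extend e (vals y) 0
  have hge : ∀ y j, g y (e j) = vals y j := fun y j => he.extend_apply _ _ _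
  have hg0 : ∀ y v, v ∉ range e → g y v = 0 := by
    intro y v hv
    have : ¬ ∃ a, e a = v := hv
    simp only [g, extend_apply' _ _ _ this, Pi.zero_apply]
  have hpm : ∀ a : ℝ, max a 0 + max (-a) 0 = |a| := by
    intro a
    rcases le_total 0 a with h | h
    · rw [max_eq_left h, max_eq_right (by linarith), abs_of_nonneg h, add_zero]
    · rw [max_eq_right h, max_eq_left (by linarith), abs_of_nonpos h, zero_add]
  have hmm : ∀ a : ℝ, max a 0 - max (-a) 0 = a := by
    intro a
    rcases le_total 0 a with h | h
    · rw [max_eq_left h, max_eq_right (by linarith), sub_zero]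
    · rw [max_eq_right h, max_eq_left (by linarith)]; ring
  have hgsum : ∀ y, ∑ v, g y v = 1 := by
    intro y
    rw [hsum _ (hg0 y)]
    simp only [hge, vals]
    have : ∀ i, max (y i) 0 / 2 + max (-y i) 0 / 2 = |y i| / 2 := by
      intro i; rw [← hpm]; ring
    simp only [this]
    rw [← Finset.sum_div, N1]; ring
  have hYc : Continuous Y := by
    refine (PiLp.continuous_toLp 2 _).comp ?_
    fun_prop
  have hgc : Continuous g := by
    refine continuous_pi fun v => ?_
    by_cases hv : v ∈ range e
    · obtain ⟨j, rfl⟩ := hv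
      simp only [hge]
      rcases j with _ | i | i
      · exact continuous_const.sub (N1_cont.div_const 2)
      · simp only [vals]; fun_prop
      · simp only [vals]; fun_prop
    · have : (fun y => g y v) = fun _ => 0 := by funext y; exact hg0 y v hv
      rw [this]; exact continuous_const
  have hYN : ∀ f ∈ R, N1 (Y f) = 2 * (1 - f (e none)) := by
    intro f hf
    obtain ⟨h1, h2, h3, h4, h5⟩ := (hR f).1 hf
    rw [hsum f h2] at h5
    have : ∀ i, |Y f i| = 2 * (f (e (some (Sum.inl i))) + f (e (some (Sum.inr i)))) := by
      intro i
      rw [hYi]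
      have a1 := h1 (e (some (Sum.inl i)))
      have a2 := h1 (e (some (Sum.inr i)))
      rcases h3 i with h | h <;> rw [h]
      · rw [abs_of_nonpos (by linarith)]; ring
      · rw [abs_of_nonneg (by linarith)]; ring
    simp only [N1, this]
    rw [← Finset.mul_sum]; linarith
  have hYT : ∀ f ∈ R, Y f ∈ Theta k Z := by
    intro f hf
    have hN := hYN f hf
    obtain ⟨h1, h2, h3, h4, h5⟩ := (hR f).1 hf
    refine ⟨by rw [hN]; linarith [h1 (e none)], ?_⟩
    rcases h4 with h4 | ⟨i, hi, ha, hb⟩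
    · left; rw [hN, h4]; ring
    · right; exact ⟨i, hi, by rw [hYi, ha, hb]; ring⟩
  have hgR : ∀ y ∈ Theta k Z, g y ∈ R := by
    rintro y ⟨hy1, hy2⟩
    rw [hR]
    refine ⟨fun v => ?_, hg0 y, fun i => ?_, ?_, hgsum y⟩
    · by_cases hv : v ∈ range e
      · obtain ⟨j, rfl⟩ := hv
        rw [hge]
        rcases j with _ | i | i
        · simp only [vals]; linarith
        · simp only [vals]; have := le_max_right (y i) 0; linarith
        · simp only [vals]; have := le_max_right (-y i) 0; linarith
      · rw [hg0 y v hv]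
    · simp only [hge, vals]
      rcases le_total 0 (y i) with h | h
      · right; rw [max_eq_right (by linarith)]; simp
      · left; rw [max_eq_right (by linarith)]; simp
    · simp only [hge, vals]
      rcases hy2 with h | ⟨i, hi, h⟩
      · left; rw [h]; norm_num
      · right; exact ⟨i, hi, by simp [h]⟩
  have hYg : ∀ y, Y (g y) = y := by
    intro y
    ext i
    rw [hYi, hge, hge]
    simp only [vals]
    linarith [hmm (y i)]
  have hgY : ∀ f ∈ R, g (Y f) = f := by
    intro f hf
    have hN := hYN f hf
    obtain ⟨h1, h2, h3, h4, h5⟩ := (hR f).1 hf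
    funext v
    by_cases hv : v ∈ range e
    · obtain ⟨j, rfl⟩ := hv
      rw [hge]
      rcases j with _ | i | i
      · simp only [vals, hN]; ring
      all_goals
        simp only [vals, hYi]
        have a1 := h1 (e (some (Sum.inl i)))
        have a2 := h1 (e (some (Sum.inr i)))
        rcases h3 i with h | h <;> rw [h]
        · first
          | rw [max_eq_right (by linarith)]; ring
          | rw [max_eq_left (by linarith)]; ring
        · first
          | rw [max_eq_left (by linarith)]; ring
          | rw [max_eq_right (by linarith)]; ring
    · rw [hg0 _ v hv, h2 v hv]
  let H : R ≃ₜ Theta k Z :=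
    { toFun := fun f => ⟨Y f, hYT f f.2⟩
      invFun := fun y => ⟨g y, hgR y y.2⟩
      left_inv := fun f => Subtype.ext (hgY f f.2)
      right_inv := fun y => Subtype.ext (hYg y)
      continuous_toFun := by fun_prop
      continuous_invFun := by fun_prop }
  exact ⟨H.toHomotopyEquiv⟩

theorem ind_eq (n : ℕ) (hn : 3 ≤ n) :
    indRealization (SimpleGraph.cycleGraph n) = RR n (Rl n) (Sm n) := by
  obtain ⟨N, rfl⟩ : ∃ N, n = N + 3 := ⟨n - 3, by omega⟩
  have hadj : ∀ a b : Fin (N + 3), (SimpleGraph.cycleGraph (N + 3)).Adj a b ↔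
      Rl (N + 3) a b ∨ Rl (N + 3) b a := by
    intro a b
    rw [SimpleGraph.cycleGraph_adj']
    have ha := a.2
    have hb := b.2
    simp only [Rl, Fin.sub_def]
    have key : ∀ x y : ℕ, x < N + 3 → y < N + 3 → ((N + 3 - y + x) % (N + 3) = 1 ↔
        (x = y + 1 ∨ (x = 0 ∧ y + 1 = N + 3))) := by
      intro x y hx hy
      rcases lt_or_ge x y with h | h
      · rw [Nat.mod_eq_of_lt (by omega)]; omega
      · have : N + 3 - y + x = (x - y) + (N + 3) := by omega
        rw [this, Nat.add_mod_right, Nat.mod_eq_of_lt (by omega)]; omega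
    rw [key _ _ ha hb, key _ _ hb ha]
    omega
  ext f
  simp only [indRealization, indRealizationIn, RR, isIndepSet, mem_ofPred_eq]
  rw [finsum_eq_sum_of_fintype]
  constructor
  · rintro ⟨h1, -, -, h2, h3⟩
    refine ⟨h1, fun v _ => Or.inl v.2, fun a b ha hb h => ?_, h3⟩
    have hadj' := (hadj a b).2 (Or.inl h)
    exact h2 (mem_support.2 ha) (mem_support.2 hb) hadj'.ne hadj'
  · rintro ⟨h1, -, h2, h3⟩
    refine ⟨h1, Set.toFinite _, Set.subset_univ _, fun a ha b hb _ h => ?_, h3⟩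
    rcases (hadj a b).1 h with h | h
    · exact h2 a b ha hb h
    · exact h2 b a hb ha h

/-- index map built from numerical functions -/
def mkE (n k : ℕ) (p q : ℕ → ℕ) (c : ℕ) (hp : ∀ i < k, p i < n) (hq : ∀ i < k, q i < n)
    (hc : c < n) : Option (Fin k ⊕ Fin k) → Fin n
  | none => ⟨c, hc⟩
  | some (Sum.inl i) => ⟨p i, hp i i.2⟩
  | some (Sum.inr i) => ⟨q i, hq i i.2⟩

theorem RR_pairs (n k : ℕ) (p q : ℕ → ℕ) (c : ℕ) (hp : ∀ i < k, p i < n) (hq : ∀ i < k, q i < n)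
    (hc : c < n) (rel : ℕ → ℕ → Prop) (S : ℕ → Prop) (Z : Set (Fin k))
    (hpp : ∀ i j, p i = p j → i = j) (hqq : ∀ i j, q i = q j → i = j)
    (hpq : ∀ i j, p i ≠ q j) (hpc : ∀ i, p i ≠ c) (hqc : ∀ i, q i ≠ c)
    (hSp : ∀ i < k, S (p i)) (hSq : ∀ i < k, S (q i)) (hSc : Z.Nonempty ↔ S c)
    (hS : ∀ v < n, S v → v = c ∨ ∃ i < k, v = p i ∨ v = q i)
    (hrel1 : ∀ i < k, rel (p i) (q i))
    (hrel2 : ∀ i : Fin k, i ∈ Z → (rel (p i) c ∨ rel c (p i)) ∧ (rel (q i) c ∨ rel c (q i)))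
    (hZ : ∀ i ∈ Z, ∀ j ∈ Z, i = j)
    (hrel : ∀ a b, a < n → b < n → S a → S b → rel a b →
      (∃ i < k, a = p i ∧ b = q i) ∨ (∃ i : Fin k, i ∈ Z ∧
        ((a = p i ∧ b = c) ∨ (b = p i ∧ a = c) ∨ (a = q i ∧ b = c) ∨ (b = q i ∧ a = c)))) :
    HE (RR n rel S) (Theta k Z) := by
  let e := mkE n k p q c hp hq hc
  have he : Injective e := by
    rintro (_ | i | i) (_ | j | j) h <;> simp only [e, mkE, Fin.mk.injEq] at h
    · rfl
    · exact absurd h.symm (hpc _)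
    · exact absurd h.symm (hqc _)
    · exact absurd h (hpc _)
    · rw [Fin.ext (hpp _ _ h)]
    · exact absurd h (hpq _ _)
    · exact absurd h (hqc _)
    · exact absurd h.symm (hpq _ _)
    · rw [Fin.ext (hqq _ _ h)]
  refine RR_theta n k e he Z _ fun f => ?_
  constructor
  · rintro ⟨h1, h2, h3, h4⟩
    refine ⟨h1, fun v hv => ?_, fun i => ?_, ?_, h4⟩
    · by_contra h0
      apply hv
      rcases hS v v.2 (h2 v h0) with h | ⟨i, hi, h | h⟩
      · exact ⟨none, Fin.ext h.symm⟩
      · exact ⟨some (Sum.inl ⟨i, hi⟩), Fin.ext h.symm⟩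
      · exact ⟨some (Sum.inr ⟨i, hi⟩), Fin.ext h.symm⟩
    · by_contra hcon
      push Not at hcon
      exact h3 _ _ hcon.1 hcon.2 (hrel1 i i.2)
    · by_cases h0 : f (e none) = 0
      · exact Or.inl h0
      right
      obtain ⟨i, hi⟩ := hSc.2 (h2 _ h0)
      refine ⟨i, hi, ?_, ?_⟩
      · by_contra hcon
        rcases (hrel2 i hi).1 with h | h
        · exact h3 _ _ hcon h0 h
        · exact h3 _ _ h0 hcon h
      · by_contra hcon
        rcases (hrel2 i hi).2 with h | h
        · exact h3 _ _ hcon h0 h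
        · exact h3 _ _ h0 hcon h
  · rintro ⟨h1, h2, h3, h4, h5⟩
    have hSf : ∀ v : Fin n, f v ≠ 0 → S v := by
      intro v hv
      by_cases hr : v ∈ range e
      · obtain ⟨(_ | i | i), rfl⟩ := hr
        · rcases h4 with h4 | ⟨i, hi, -⟩
          · exact absurd h4 hv
          · exact hSc.1 ⟨i, hi⟩
        · exact hSp i i.2
        · exact hSq i i.2
      · exact absurd (h2 v hr) hv
    refine ⟨h1, hSf, fun a b ha hb h => ?_, h5⟩
    rcases hrel a b a.2 b.2 (hSf a ha) (hSf b hb) h with ⟨i, hi, h6, h7⟩ | ⟨i, hi, h6⟩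
    · have e1 : a = e (some (Sum.inl ⟨i, hi⟩)) := Fin.ext h6
      have e2 : b = e (some (Sum.inr ⟨i, hi⟩)) := Fin.ext h7
      rw [e1] at ha
      rw [e2] at hb
      rcases h3 ⟨i, hi⟩ with h | h
      · exact ha h
      · exact hb h
    · have hz : f (e none) ≠ 0 → f (e (some (Sum.inl i))) = 0 ∧ f (e (some (Sum.inr i))) = 0 := by
        intro h0
        rcases h4 with h4 | ⟨j, hj, h7⟩
        · exact absurd h4 h0
        · rw [hZ i hi j hj]; exact h7
      rcases h6 with ⟨h6, h7⟩ | ⟨h6, h7⟩ | ⟨h6, h7⟩ | ⟨h6, h7⟩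
      · have e1 : a = e (some (Sum.inl i)) := Fin.ext h6
        have e2 : b = e none := Fin.ext h7
        exact ha (e1 ▸ (hz (e2 ▸ hb)).1)
      · have e1 : b = e (some (Sum.inl i)) := Fin.ext h6
        have e2 : a = e none := Fin.ext h7
        exact hb (e1 ▸ (hz (e2 ▸ ha)).1)
      · have e1 : a = e (some (Sum.inr i)) := Fin.ext h6
        have e2 : b = e none := Fin.ext h7
        exact ha (e1 ▸ (hz (e2 ▸ hb)).2)
      · have e1 : b = e (some (Sum.inr i)) := Fin.ext h6
        have e2 : a = e none := Fin.ext h7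
        exact hb (e1 ▸ (hz (e2 ▸ ha)).2)

theorem Theta_empty (k : ℕ) : HE (Theta k ∅) (sphere' k) := by
  refine HE.trans (HE.of_eq ?_) (sphere_N1 k)
  ext x
  simp only [Theta, mem_ofPred_eq, mem_empty_iff_false, false_and, exists_false, or_false]
  constructor
  · exact fun h => h.2
  · exact fun h => ⟨h.le, h⟩

theorem case0 (d : ℕ) : HE (RR (3 + 3 * d) (Rl 3) (Sm 3)) (sphereWedge d) := by
  refine HE.trans ?_ ((hole_theta d).symm.trans (hole_tangent d))
  refine RR_pairs _ _ (fun i => 3 * i) (fun i => 3 * i + 1) 2 (by intros; omega)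
    (by intros; omega) (by omega) _ _ _ (by intros; omega) (by intros; omega) (by intros; omega)
    (by intros; omega) (by intros; omega) ?_ ?_ ?_ ?_ ?_ ?_ ?_ ?_
  · intro i hi; unfold Sm; omega
  · intro i hi; unfold Sm; omega
  · simp [Sm]
  · intro v hv hS
    by_cases h2 : v = 2
    · exact Or.inl h2
    · refine Or.inr ⟨v / 3, by omega, ?_⟩
      unfold Sm at hS; omega
  · intro i hi; unfold Rl; omega
  · intro i hi
    rw [mem_singleton_iff] at hi
    subst hi
    simp [Rl]
  · intro i hi j hj
    rw [mem_singleton_iff] at hi hj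
    rw [hi, hj]
  · intro a b ha hb hSa hSb h
    by_cases h2 : b = 2
    · right
      refine ⟨0, rfl, ?_⟩
      unfold Rl at h
      simp only [Fin.val_zero]
      omega
    · left
      refine ⟨a / 3, by omega, ?_⟩
      unfold Rl at h
      unfold Sm at hSa
      omega

theorem case1 (d : ℕ) : HE (RR (4 + 3 * d) (Rl 4) (fun a => a % 3 ≠ 0)) (sphere' (d + 1)) := by
  refine HE.trans ?_ (Theta_empty (d + 1))
  refine RR_pairs _ _ (fun i => 3 * i + 1) (fun i => 3 * i + 2) 0 (by intros; omega)
    (by intros; omega) (by omega) _ _ _ (by intros; omega) (by intros; omega) (by intros; omega)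
    (by intros; omega) (by intros; omega) ?_ ?_ ?_ ?_ ?_ ?_ ?_ ?_
  · intro i hi; omega
  · intro i hi; omega
  · simp
  · intro v hv hS
    exact Or.inr ⟨v / 3, by omega, by omega⟩
  · intro i hi; unfold Rl; omega
  · intro i hi; exact absurd hi (notMem_empty i)
  · intro i hi; exact absurd hi (notMem_empty i)
  · intro a b ha hb hSa hSb h
    left
    refine ⟨a / 3, by omega, ?_⟩
    unfold Rl at h
    omega

theorem case2 (d : ℕ) : HE (RR (5 + 3 * d) (Rl 2) (Sm 2)) (sphere' (d + 2)) := by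
  refine HE.trans ?_ (Theta_empty (d + 2))
  refine RR_pairs _ _ (fun i => 3 * i - 1) (fun i => max (3 * i) 1) 4 (by intros; omega)
    (by intros; omega) (by omega) _ _ _ (by intros; omega) (by intros; omega) (by intros; omega)
    (by intros; omega) (by intros; omega) ?_ ?_ ?_ ?_ ?_ ?_ ?_ ?_
  · intro i hi; unfold Sm; omega
  · intro i hi; unfold Sm; omega
  · simp [Sm]
  · intro v hv hS
    unfold Sm at hS
    by_cases h2 : v < 2
    · exact Or.inr ⟨0, by omega, by omega⟩
    · exact Or.inr ⟨(v + 1) / 3, by omega, by omega⟩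
  · intro i hi; unfold Rl; omega
  · intro i hi; exact absurd hi (notMem_empty i)
  · intro i hi; exact absurd hi (notMem_empty i)
  · intro a b ha hb hSa hSb h
    left
    unfold Rl at h
    refine ⟨(a + 1) / 3, by omega, ?_⟩
    omega

/-- homotopy type of the independence complex of the cycle `C_n`
(`n ≥ 3`): `S^{k-1} ∨ S^{k-1}` if `n = 3k`, `S^{k-1}` if `n = 3k+1`,
and `S^k` if `n = 3k+2`. -/
theorem ind_cycleGraph (n k : ℕ) (hn : 3 ≤ n) :
    (n = 3 * k → Nonempty (ContinuousMap.HomotopyEquiv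
      (↥(indRealization (SimpleGraph.cycleGraph n))) (↥(sphereWedge (k - 1))))) ∧
    (n = 3 * k + 1 → Nonempty (ContinuousMap.HomotopyEquiv
      (↥(indRealization (SimpleGraph.cycleGraph n))) (↥(sphere' k)))) ∧
    (n = 3 * k + 2 → Nonempty (ContinuousMap.HomotopyEquiv
      (↥(indRealization (SimpleGraph.cycleGraph n))) (↥(sphere' (k + 1))))) := by
  refine ⟨fun h => ?_, fun h => ?_, fun h => ?_⟩
  · obtain ⟨d, rfl⟩ : ∃ d, k = d + 1 := ⟨k - 1, by omega⟩
    obtain rfl : n = 3 + 3 * d := by omega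
    rw [ind_eq _ hn]
    exact (steps _ 3 d (by omega) le_rfl).trans (case0 d)
  · obtain ⟨d, rfl⟩ : ∃ d, k = d + 1 := ⟨k - 1, by omega⟩
    obtain rfl : n = 4 + 3 * d := by omega
    rw [ind_eq _ hn]
    exact (steps _ 4 d (by omega) le_rfl).trans ((step4 _ (by omega)).trans (case1 d))
  · obtain ⟨d, rfl⟩ : ∃ d, k = d + 1 := ⟨k - 1, by omega⟩
    have e : n = 2 + 3 * (d + 1) := by omega
    obtain rfl : n = 5 + 3 * d := by omega
    rw [ind_eq _ hn]
    have h1 := steps (5 + 3 * d) 2 (d + 1) (by omega) (by omega)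
    rw [← e] at h1
    exact h1.trans (case2 d)
end

section
/- For n ≥ 1, the independence complex of the hexagonal line tiling H_{1×1×n} is homotopy equivalent to a wedge of two n-dimensional spheres S^n ∨ S^n. -/
open Function Set

section HexAux
open ContinuousMap

/-- Geometric realization of a family of faces on a finite vertex set. -/
def hxReal {V : Type*} [Fintype V] (K : Set V → Prop) : Set (V → ℝ) :=
  {f | (∀ v, 0 ≤ f v) ∧ ∑ v, f v = 1 ∧ K (Function.support f)}

/-- Downward closed families. -/
def hxDown {V : Type*} (K : Set V → Prop) : Prop := ∀ s t : Set V, s ⊆ t → K t → K s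

/-- Homotopy equivalence of realizations. -/
def hxEq {V W : Type*} [Fintype V] [Fintype W] (K : Set V → Prop) (L : Set W → Prop) : Prop :=
  Nonempty (ContinuousMap.HomotopyEquiv (↥(hxReal K)) (↥(hxReal L)))

lemma hxEq_trans {V W U : Type*} [Fintype V] [Fintype W] [Fintype U] {K : Set V → Prop}
    {L : Set W → Prop} {N : Set U → Prop} (h : hxEq K L) (h' : hxEq L N) : hxEq K N := by
  obtain ⟨a⟩ := h
  obtain ⟨b⟩ := h'
  exact ⟨a.trans b⟩

lemma hxEq_of_iff {V : Type*} [Fintype V] {K L : Set V → Prop} (h : ∀ s, K s ↔ L s) :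
    hxEq K L := by
  have : K = L := funext fun s => propext (h s)
  subst this
  exact ⟨ContinuousMap.HomotopyEquiv.refl _⟩

/-- Contiguous maps are homotopic. -/
lemma hx_homotopic {X V : Type*} [TopologicalSpace X] [Fintype V] {K : Set V → Prop}
    (hK : hxDown K) (f g : C(X, ↥(hxReal K)))
    (h : ∀ x, K (Function.support (f x : V → ℝ) ∪ Function.support (g x : V → ℝ))) :
    f.Homotopic g := by
  have key : ∀ p : unitInterval × X,
      (fun v => (1 - (p.1 : ℝ)) * (f p.2 : V → ℝ) v + (p.1 : ℝ) * (g p.2 : V → ℝ) v) ∈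
        hxReal K := by
    rintro ⟨t, x⟩
    obtain ⟨hf0, hf1, hf2⟩ := (f x).2
    obtain ⟨hg0, hg1, hg2⟩ := (g x).2
    have ht0 := t.2.1
    have ht1 := t.2.2
    refine ⟨fun v => ?_, ?_, ?_⟩
    · have := mul_nonneg (sub_nonneg.2 ht1) (hf0 v)
      have := mul_nonneg ht0 (hg0 v)
      simp only
      linarith
    · simp only
      rw [Finset.sum_add_distrib, ← Finset.mul_sum, ← Finset.mul_sum, hf1, hg1]
      ring
    · refine hK _ _ ?_ (h x)
      intro v hv
      by_contra hcon
      simp only [Set.mem_union, Function.mem_support, not_or, not_not] at hcon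
      apply hv
      simp [hcon.1, hcon.2]
  refine ⟨⟨⟨fun p => ⟨_, key p⟩, ?_⟩, ?_, ?_⟩⟩
  · refine Continuous.subtype_mk ?_ _
    refine continuous_pi fun v => ?_
    have h1 : Continuous fun p : unitInterval × X => (f p.2 : V → ℝ) v :=
      (continuous_apply v).comp (continuous_subtype_val.comp (f.continuous.comp continuous_snd))
    have h2 : Continuous fun p : unitInterval × X => (g p.2 : V → ℝ) v :=
      (continuous_apply v).comp (continuous_subtype_val.comp (g.continuous.comp continuous_snd))
    have h3 : Continuous fun p : unitInterval × X => (p.1 : ℝ) :=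
      continuous_subtype_val.comp continuous_fst
    exact ((continuous_const.sub h3).mul h1).add (h3.mul h2)
  · intro x
    apply Subtype.ext
    funext v
    simp
  · intro x
    apply Subtype.ext
    funext v
    simp

/-- The basic collapse. -/
lemma hx_move {V : Type*} [Fintype V] [DecidableEq V] {K : Set V → Prop}
    (hK : hxDown K) (τ : Finset V) (hτ : τ.Nonempty) (y : V) (hy : y ∉ τ)
    (h : ∀ σ, K σ → (↑τ : Set V) ⊆ σ → K (insert y σ)) :
    hxEq K (fun σ => K σ ∧ ¬ (↑τ : Set V) ⊆ σ) := by
  set m : (V → ℝ) → ℝ := fun f => τ.inf' hτ f with hm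
  have mcont : Continuous m := by
    have : Continuous fun f : V → ℝ => τ.inf' hτ (fun i => f i) :=
      Continuous.finset_inf'_apply hτ (fun i _ => continuous_apply i)
    exact this
  set r : (V → ℝ) → (V → ℝ) := fun f v =>
    f v - (if v ∈ τ then m f else 0) + (if v = y then (τ.card : ℝ) * m f else 0) with hr
  have rcont : Continuous r := by
    refine continuous_pi fun v => ?_
    simp only [hr]
    split_ifs <;> fun_prop
  have mnn : ∀ f ∈ hxReal K, 0 ≤ m f := by
    intro f hf
    exact Finset.le_inf' _ _ fun v _ => hf.1 v
  have m0 : ∀ f ∈ hxReal K, m f = 0 → ¬ (↑τ : Set V) ⊆ Function.support f := by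
    intro f hf h0 hs
    obtain ⟨i, hi, hi'⟩ := Finset.exists_mem_eq_inf' hτ f
    exact hs hi (hi'.symm.trans h0)
  have mpos : ∀ f ∈ hxReal K, m f ≠ 0 → (↑τ : Set V) ⊆ Function.support f := by
    intro f hf h0 v hv h1
    have : m f ≤ f v := Finset.inf'_le _ hv
    exact h0 (le_antisymm (this.trans h1.le) (mnn f hf))
  have req : ∀ f, m f = 0 → r f = f := by
    intro f h0
    funext v
    simp [hr, h0]
  have runion : ∀ f ∈ hxReal K, K (Function.support (r f) ∪ Function.support f) := by
    intro f hf
    by_cases h0 : m f = 0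
    · rw [req f h0, Set.union_self]; exact hf.2.2
    · refine hK _ _ ?_ (h _ hf.2.2 (mpos f hf h0))
      refine Set.union_subset ?_ (Set.subset_insert _ _)
      intro v hv
      by_contra hcon
      simp only [Set.mem_insert_iff, Function.mem_support, not_or, not_not] at hcon
      have : v ∉ τ := fun hvτ => mpos f hf h0 hvτ hcon.2
      apply hv
      simp [hr, hcon.1, hcon.2, this]
  have rmem : ∀ f ∈ hxReal K, r f ∈ hxReal (fun σ => K σ ∧ ¬ (↑τ : Set V) ⊆ σ) := by
    intro f hf
    refine ⟨fun v => ?_, ?_, ?_, ?_⟩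
    · have h1 : 0 ≤ f v - (if v ∈ τ then m f else 0) := by
        split_ifs with hv
        · exact sub_nonneg.2 (Finset.inf'_le _ hv)
        · simpa using hf.1 v
      have h2 : 0 ≤ (if v = y then (τ.card : ℝ) * m f else 0) := by
        split_ifs
        · exact mul_nonneg (Nat.cast_nonneg _) (mnn f hf)
        · exact le_rfl
      exact add_nonneg h1 h2
    · simp only [hr]
      rw [Finset.sum_add_distrib, Finset.sum_sub_distrib, hf.2.1]
      simp
    · exact hK _ _ Set.subset_union_left (runion f hf)
    · by_cases h0 : m f = 0
      · rw [req f h0]; exact m0 f hf h0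
      · intro hs
        obtain ⟨i, hi, hi'⟩ := Finset.exists_mem_eq_inf' hτ f
        apply hs hi
        have hiy : i ≠ y := fun h => hy (h ▸ hi)
        have hi2 : m f = f i := hi'
        simp only [hr, if_pos (Finset.mem_coe.1 hi), if_neg hiy, hi2]
        ring
  have imem : ∀ f ∈ hxReal (fun σ => K σ ∧ ¬ (↑τ : Set V) ⊆ σ), f ∈ hxReal K :=
    fun f hf => ⟨hf.1, hf.2.1, hf.2.2.1⟩
  let F : C(↥(hxReal K), ↥(hxReal (fun σ => K σ ∧ ¬ (↑τ : Set V) ⊆ σ))) :=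
    ⟨fun f => ⟨r f, rmem f f.2⟩, (rcont.comp continuous_subtype_val).subtype_mk _⟩
  let I : C(↥(hxReal (fun σ => K σ ∧ ¬ (↑τ : Set V) ⊆ σ)), ↥(hxReal K)) :=
    ⟨fun f => ⟨f, imem f f.2⟩, continuous_subtype_val.subtype_mk _⟩
  refine ⟨⟨F, I, ?_, ?_⟩⟩
  · apply hx_homotopic hK
    intro f
    exact runion f f.2
  · have : F.comp I = ContinuousMap.id _ := by
      ext1 f
      apply Subtype.ext
      change r f = f
      apply req
      by_contra h0
      exact f.2.2.2.2 (mpos f (imem f f.2) h0)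
    rw [this]

lemma hx_moves {V : Type*} [Fintype V] [DecidableEq V] {K K' : Set V → Prop}
    (hK : hxDown K) (T : Set (Finset V)) (y : V)
    (hT : ∀ τ ∈ T, τ.Nonempty ∧ y ∉ τ ∧ ∀ σ, K σ → (↑τ : Set V) ⊆ σ → K (insert y σ))
    (hK' : ∀ σ, K' σ ↔ K σ ∧ ∀ τ ∈ T, ¬ (↑τ : Set V) ⊆ σ) :
    hxEq K K' := by
  have main : ∀ S : Finset (Finset V), (↑S : Set (Finset V)) ⊆ T →
      hxEq K (fun σ => K σ ∧ ∀ τ ∈ S, ¬ (↑τ : Set V) ⊆ σ) := by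
    intro S
    induction S using Finset.induction_on with
    | empty => intro _; exact hxEq_of_iff (by simp)
    | insert τ S hτ ih =>
      intro hS
      have hS' : (↑S : Set (Finset V)) ⊆ T := fun a ha => hS (by simp [Finset.mem_coe.1 ha])
      refine hxEq_trans (ih hS') ?_
      obtain ⟨h1, h2, h3⟩ := hT τ (hS (by simp))
      refine hxEq_trans (hx_move ?_ τ h1 y h2 ?_) (hxEq_of_iff ?_)
      · intro s t hst ht
        exact ⟨hK _ _ hst ht.1, fun a ha hs => ht.2 a ha (hs.trans hst)⟩
      · intro σ hσ hτσ
        refine ⟨h3 σ hσ.1 hτσ, fun a ha hs => hσ.2 a ha ?_⟩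
        intro v hv
        rcases hs hv with h | h
        · exact absurd (h ▸ hv) (hT a (hS' ha)).2.1
        · exact h
      · intro σ
        simp only [Finset.mem_insert, forall_eq_or_imp]
        tauto
  refine hxEq_trans (main (Set.toFinite T).toFinset (by simp)) (hxEq_of_iff ?_)
  intro σ
  rw [hK']
  simp

/-- Duplicating vertices does not change the homotopy type. -/
lemma hx_pull {V W : Type*} [Fintype V] [Fintype W] [DecidableEq V] [DecidableEq W]
    {K : Set V → Prop} (hK : hxDown K) (π : W → V) (hπ : Function.Surjective π) :
    hxEq K (fun σ : Set W => K (π '' σ)) := by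
  obtain ⟨s, hs⟩ := hπ.hasRightInverse
  have hK2 : hxDown (fun σ : Set W => K (π '' σ)) :=
    fun a b hab hb => hK _ _ (Set.image_mono hab) hb
  set P : (W → ℝ) → (V → ℝ) := fun f v => ∑ w, if π w = v then f w else 0 with hP
  set Q : (V → ℝ) → (W → ℝ) := fun g w => if w = s (π w) then g (π w) else 0 with hQ
  have Pcont : Continuous P := by
    refine continuous_pi fun v => continuous_finsetSum _ fun w _ => ?_
    by_cases h : π w = v <;> simp only [h, if_true, if_false] <;> fun_prop
  have Qcont : Continuous Q := by
    refine continuous_pi fun w => ?_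
    simp only [hQ]
    split_ifs <;> fun_prop
  have Psupp : ∀ f, Function.support (P f) ⊆ π '' Function.support f := by
    intro f v hv
    by_contra hcon
    apply hv
    refine Finset.sum_eq_zero fun w _ => ?_
    split_ifs with hw
    · by_contra hne
      exact hcon ⟨w, hne, hw⟩
    · rfl
  have Qsupp : ∀ g, π '' Function.support (Q g) ⊆ Function.support g := by
    rintro g _ ⟨w, hw, rfl⟩ h0
    apply hw
    simp only [hQ, h0, ite_self]
  have PQ : ∀ g, P (Q g) = g := by
    intro g
    funext v
    simp only [hP, hQ]
    rw [Finset.sum_eq_single (s v)]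
    · simp [hs v]
    · intro w _ hw
      split_ifs with h1 h2
      · exact absurd (h1 ▸ h2) hw
      · rfl
      · rfl
    · simp
  have Psum : ∀ f, ∑ v, P f v = ∑ w, f w := by
    intro f
    simp only [hP]
    rw [Finset.sum_comm]
    simp
  have Pmem : ∀ f ∈ hxReal (fun σ : Set W => K (π '' σ)), P f ∈ hxReal K := by
    intro f hf
    refine ⟨fun v => Finset.sum_nonneg fun w _ => ?_, (Psum f).trans hf.2.1,
      hK _ _ (Psupp f) hf.2.2⟩
    split_ifs
    · exact hf.1 w
    · exact le_rfl
  have Qmem : ∀ g ∈ hxReal K, Q g ∈ hxReal (fun σ : Set W => K (π '' σ)) := by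
    intro g hg
    refine ⟨fun w => ?_, ?_, hK _ _ (Qsupp g) hg.2.2⟩
    · simp only [hQ]
      split_ifs
      · exact hg.1 _
      · exact le_rfl
    · rw [← Psum, PQ]; exact hg.2.1
  let F : C(↥(hxReal (fun σ : Set W => K (π '' σ))), ↥(hxReal K)) :=
    ⟨fun f => ⟨P f, Pmem f f.2⟩, (Pcont.comp continuous_subtype_val).subtype_mk _⟩
  let I : C(↥(hxReal K), ↥(hxReal (fun σ : Set W => K (π '' σ)))) :=
    ⟨fun f => ⟨Q f, Qmem f f.2⟩, (Qcont.comp continuous_subtype_val).subtype_mk _⟩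
  refine ⟨⟨I, F, ?_, ?_⟩⟩
  · have : F.comp I = ContinuousMap.id _ := by
      ext1 f
      apply Subtype.ext
      exact PQ f
    rw [this]
  · apply hx_homotopic hK2
    intro f
    refine hK _ _ ?_ f.2.2.2
    rw [Set.image_union]
    exact Set.union_subset ((Qsupp _).trans (Psupp _)) (le_refl _)

/-- Vertices of the model: a base vertex, and on each of two sides an antipode of the base vertex
together with `n` antipodal pairs. -/
abbrev hxM (n : ℕ) : Type := Option (Bool × Option (Fin n × Bool))

def hxRow {n : ℕ} : hxM n → ℕ
  | none => 0
  | some (_, none) => 0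
  | some (true, some (j, _)) => if (j : ℕ) = 0 then 1 else (j : ℕ) % 2
  | some (false, some (j, _)) => ((j : ℕ) + 1) % 2

def hxCol {n : ℕ} : hxM n → ℕ
  | none => 1
  | some (true, none) => 2
  | some (false, none) => 0
  | some (true, some (j, true)) => 2 * (j : ℕ) + 1
  | some (true, some (j, false)) => if (j : ℕ) = 0 then 0 else 2 * (j : ℕ) + 2
  | some (false, some (j, true)) => 2 * (j : ℕ) + 1
  | some (false, some (j, false)) => 2 * (j : ℕ) + 2

def hxAdj {n : ℕ} (a b : hxM n) : Prop :=
  (hxRow a = hxRow b ∧ (hxCol a + 1 = hxCol b ∨ hxCol b + 1 = hxCol a)) ∨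
  (hxRow a ≠ hxRow b ∧ hxCol a = hxCol b ∧ hxCol a % 2 = 0)

lemma hxAdj_symm {n : ℕ} {a b : hxM n} (h : hxAdj a b) : hxAdj b a := by
  unfold hxAdj at *
  omega

lemma hxAdj_irrefl {n : ℕ} (a : hxM n) : ¬ hxAdj a a := by
  unfold hxAdj
  omega

lemma hxRow_lt {n : ℕ} (m : hxM n) : hxRow m < 2 := by
  rcases m with _ | ⟨_ | _, _ | ⟨j, _ | _⟩⟩ <;> simp only [hxRow] <;> (try split_ifs) <;> omega

lemma hxCol_lt {n : ℕ} (hn : 1 ≤ n) (m : hxM n) : hxCol m < 2 * n + 1 := by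
  rcases m with _ | ⟨_ | _, _ | ⟨j, _ | _⟩⟩ <;> simp only [hxCol] <;> (try split_ifs) <;> omega

def hxPi {n : ℕ} (hn : 1 ≤ n) (m : hxM n) : Fin 2 × Fin (2 * n + 1) :=
  (⟨hxRow m, hxRow_lt m⟩, ⟨hxCol m, hxCol_lt hn m⟩)

lemma hxPi_adj {n : ℕ} (hn : 1 ≤ n) (a b : hxM n) :
    (hexRow n).Adj (hxPi hn a) (hxPi hn b) ↔ hxAdj a b := by
  simp only [hexRow, SimpleGraph.fromRel_adj, hxPi, hxAdj, ne_eq, Prod.mk.injEq, Fin.mk.injEq]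
  omega

lemma hxPi_surj {n : ℕ} (hn : 1 ≤ n) : Function.Surjective (hxPi hn) := by
  rintro ⟨⟨r, hr⟩, ⟨k, hk⟩⟩
  suffices h : ∃ m : hxM n, hxRow m = r ∧ hxCol m = k by
    obtain ⟨m, h1, h2⟩ := h
    exact ⟨m, by simp [hxPi, h1, h2]⟩
  by_cases hk0 : k = 0
  · by_cases hr0 : r = 0
    · exact ⟨some (false, none), by simp [hxRow, hxCol, hk0, hr0]⟩
    · refine ⟨some (true, some (⟨0, by omega⟩, false)), ?_⟩
      simp [hxRow, hxCol, hk0]; omega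
  by_cases hk1 : k = 1
  · by_cases hr0 : r = 0
    · exact ⟨none, by simp [hxRow, hxCol, hk1, hr0]⟩
    · refine ⟨some (true, some (⟨0, by omega⟩, true)), ?_⟩
      simp [hxRow, hxCol, hk1]; omega
  by_cases hk2 : k = 2 ∧ r = 0
  · exact ⟨some (true, none), by simp [hxRow, hxCol, hk2]⟩
  obtain ⟨j, hj⟩ : ∃ j, j = (k - 1) / 2 := ⟨_, rfl⟩
  have hjn : j < n := by omega
  by_cases hp : (j + 1) % 2 = r
  · by_cases hodd : k % 2 = 1
    · refine ⟨some (false, some (⟨j, hjn⟩, true)), ?_⟩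
      simp only [hxRow, hxCol]; omega
    · refine ⟨some (false, some (⟨j, hjn⟩, false)), ?_⟩
      simp only [hxRow, hxCol]; omega
  · have hj0 : j ≠ 0 := by omega
    by_cases hodd : k % 2 = 1
    · refine ⟨some (true, some (⟨j, hjn⟩, true)), ?_⟩
      simp only [hxRow, hxCol, if_neg hj0]; omega
    · refine ⟨some (true, some (⟨j, hjn⟩, false)), ?_⟩
      simp only [hxRow, hxCol, if_neg hj0]; omega

/-- Independent sets of the graph with one duplicated vertex. -/
def hxK0 (n : ℕ) (σ : Set (hxM n)) : Prop := ∀ a ∈ σ, ∀ b ∈ σ, ¬ hxAdj a b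

lemma hxK0_iff {n : ℕ} (hn : 1 ≤ n) (σ : Set (hxM n)) :
    isIndepSet (hexRow n) (hxPi hn '' σ) ↔ hxK0 n σ := by
  constructor
  · intro h a ha b hb hab
    rw [← hxPi_adj hn] at hab
    exact h ⟨a, ha, rfl⟩ ⟨b, hb, rfl⟩ hab.ne hab
  · rintro h _ ⟨a, ha, rfl⟩ _ ⟨b, hb, rfl⟩ _ hab
    rw [hxPi_adj hn] at hab
    exact h a ha b hb hab

lemma hxK0_insert {n : ℕ} {σ : Set (hxM n)} (h : hxK0 n σ) (y : hxM n)
    (hy : ∀ a ∈ σ, ¬ hxAdj y a) : hxK0 n (insert y σ) := by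
  rintro a (rfl | ha) b (rfl | hb)
  · exact hxAdj_irrefl _
  · exact hy b hb
  · exact fun h => hy a ha (hxAdj_symm h)
  · exact h a ha b hb

/-- column thresholds -/
def hxTh : ℕ → ℕ
  | 0 => 0
  | (j + 1) => 2 * j + 4

lemma hxTh_eq (j : ℕ) : hxTh j = if j = 0 then 0 else 2 * j + 2 := by
  cases j <;> simp [hxTh]; omega

/-- First stage: shrink the link of `some (false, none)`. -/
def hxK1 (n j : ℕ) (σ : Set (hxM n)) : Prop :=
  hxK0 n σ ∧ (some (false, none) ∈ σ → ∀ a, some (true, a) ∈ σ → hxTh j ≤ hxCol (some (true, a)))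

/-- Second stage: shrink the link of `some (true, none)`. -/
def hxK2 (n j : ℕ) (σ : Set (hxM n)) : Prop :=
  hxK1 n n σ ∧
    (some (true, none) ∈ σ → ∀ a, some (false, a) ∈ σ → hxTh j ≤ hxCol (some (false, a)))

lemma hxK0_down (n : ℕ) : hxDown (hxK0 n) :=
  fun _ _ hst h a ha b hb => h a (hst ha) b (hst hb)

lemma hxK1_down (n j : ℕ) : hxDown (hxK1 n j) :=
  fun s t hst h => ⟨hxK0_down n s t hst h.1, fun hc a ha => h.2 (hst hc) a (hst ha)⟩

lemma hxK2_down (n j : ℕ) : hxDown (hxK2 n j) :=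
  fun s t hst h => ⟨hxK1_down n n s t hst h.1, fun hc a ha => h.2 (hst hc) a (hst ha)⟩

lemma hx_specT {n : ℕ} (a : Option (Fin n × Bool)) :
    (hxRow (some (true, a)) = 0 ∧ hxCol (some (true, a)) = 2) ∨
    (hxRow (some (true, a)) = 1 ∧ hxCol (some (true, a)) ≤ 1) ∨
    (hxRow (some (true, a)) ≤ 1 ∧ 3 ≤ hxCol (some (true, a)) ∧
      (hxRow (some (true, a)) + (hxCol (some (true, a)) + 1) / 2) % 2 = 1) := by
  rcases a with _ | ⟨⟨i, hi⟩, _ | _⟩ <;> simp only [hxRow, hxCol] <;> (try split_ifs) <;> first | omega | simp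

lemma hx_specF {n : ℕ} (a : Option (Fin n × Bool)) :
    (a = none ∧ hxRow (some (false, a)) = 0 ∧ hxCol (some (false, a)) = 0) ∨
    (hxRow (some (false, a)) ≤ 1 ∧ 1 ≤ hxCol (some (false, a)) ∧
      (hxRow (some (false, a)) + (hxCol (some (false, a)) + 1) / 2) % 2 = 0) := by
  rcases a with _ | ⟨⟨i, hi⟩, _ | _⟩ <;> simp only [hxRow, hxCol] <;> simp <;> omega

set_option maxHeartbeats 4000000 in
/-- arithmetic of the first stage -/
lemma hx_arith1 {n : ℕ} (j : Fin n) (a : Option (Fin n × Bool)) (b : hxM n)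
    (hyb : hxAdj (some (false, some (j, true))) b)
    (h1 : hxTh j ≤ hxCol (some (true, a) : hxM n))
    (h2 : hxCol (some (true, a) : hxM n) < hxTh (j + 1))
    (hb : ∀ c, b = some (true, c) → hxTh j ≤ hxCol b) :
    hxAdj (some (true, a)) b ∨ hxAdj (some (false, none)) b ∨
      hxAdj (some (false, none)) (some (true, a)) := by
  obtain ⟨j, hj⟩ := j
  have ht : (j = 0 ∧ hxTh j = 0) ∨ (j ≠ 0 ∧ hxTh j = 2 * j + 2) := by
    rw [hxTh_eq]; split_ifs <;> omega
  have ht' : hxTh (j + 1) = 2 * j + 4 := rfl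
  have sa := hx_specT a
  have yR : hxRow (some (false, some ((⟨j, hj⟩ : Fin n), true))) = (j + 1) % 2 := rfl
  have yC : hxCol (some (false, some ((⟨j, hj⟩ : Fin n), true))) = 2 * j + 1 := rfl
  have cR : hxRow (some (false, none) : hxM n) = 0 := rfl
  have cC : hxCol (some (false, none) : hxM n) = 0 := rfl
  simp only at h1 h2 hb
  unfold hxAdj at *
  rw [yR, yC] at hyb
  rw [cR, cC]
  rw [ht'] at h2
  generalize hxRow (some (true, a)) = ra at *
  generalize hxCol (some (true, a)) = ca at *
  rcases b with _ | ⟨_ | _, b⟩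
  · have bR : hxRow (none : hxM n) = 0 := rfl
    have bC : hxCol (none : hxM n) = 1 := rfl
    rw [bR, bC] at *
    omega
  · have sb := hx_specF b
    clear hb
    generalize hxRow (some (false, b)) = rb at *
    generalize hxCol (some (false, b)) = cb at *
    rcases ht with ht | ht <;> rcases hyb with ⟨hy1, hy2 | hy2⟩ | hy1 <;>
      (try rcases sa with sa | sa | sa) <;> (try rcases sb with sb | sb | sb) <;> omega
  · have sb := hx_specT b
    replace hb := hb _ rfl
    generalize hxRow (some (true, b)) = rb at *
    generalize hxCol (some (true, b)) = cb at *
    rcases ht with ht | ht <;> rcases hyb with ⟨hy1, hy2 | hy2⟩ | hy1 <;>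
      (try rcases sa with sa | sa | sa) <;> (try rcases sb with sb | sb | sb) <;> omega

set_option maxHeartbeats 4000000 in
lemma hx_arith2 {n : ℕ} (j : Fin n) (a : Option (Fin n × Bool)) (b : hxM n)
    (hyb : hxAdj (some (true, some (j, true))) b) (hane : a ≠ none)
    (h1 : hxTh j ≤ hxCol (some (false, a) : hxM n))
    (h2 : hxCol (some (false, a) : hxM n) < hxTh (j + 1))
    (hb : ∀ c, b = some (false, c) → hxTh j ≤ hxCol b) :
    hxAdj (some (false, a)) b ∨ hxAdj (some (true, none)) b ∨
      hxAdj (some (true, none)) (some (false, a)) := by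
  obtain ⟨j, hj⟩ := j
  have ht : (j = 0 ∧ hxTh j = 0) ∨ (j ≠ 0 ∧ hxTh j = 2 * j + 2) := by
    rw [hxTh_eq]; split_ifs <;> omega
  have ht' : hxTh (j + 1) = 2 * j + 4 := rfl
  have sa := hx_specF a
  simp only [hane, false_and, false_or] at sa
  have yR : (j = 0 ∧ hxRow (some (true, some ((⟨j, hj⟩ : Fin n), true))) = 1) ∨
      (j ≠ 0 ∧ hxRow (some (true, some ((⟨j, hj⟩ : Fin n), true))) = j % 2) := by
    simp only [hxRow]; split_ifs <;> omega
  have yC : hxCol (some (true, some ((⟨j, hj⟩ : Fin n), true))) = 2 * j + 1 := rfl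
  have cR : hxRow (some (true, none) : hxM n) = 0 := rfl
  have cC : hxCol (some (true, none) : hxM n) = 2 := rfl
  simp only at h1 h2 hb
  unfold hxAdj at *
  rw [yC] at hyb
  rw [cR, cC]
  rw [ht'] at h2
  generalize hxRow (some (true, some ((⟨j, hj⟩ : Fin n), true))) = ry at *
  generalize hxRow (some (false, a)) = ra at *
  generalize hxCol (some (false, a)) = ca at *
  rcases b with _ | ⟨_ | _, b⟩
  · have bR : hxRow (none : hxM n) = 0 := rfl
    have bC : hxCol (none : hxM n) = 1 := rfl
    rw [bR, bC] at *
    omega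
  · have sb := hx_specF b
    replace hb := hb _ rfl
    generalize hxRow (some (false, b)) = rb at *
    generalize hxCol (some (false, b)) = cb at *
    rcases ht with ht | ht <;> rcases hyb with ⟨hy1, hy2 | hy2⟩ | hy1 <;>
      (try rcases sa with sa | sa | sa) <;> (try rcases sb with sb | sb | sb) <;> omega
  · have sb := hx_specT b
    clear hb
    generalize hxRow (some (true, b)) = rb at *
    generalize hxCol (some (true, b)) = cb at *
    rcases ht with ht | ht <;> rcases hyb with ⟨hy1, hy2 | hy2⟩ | hy1 <;>
      (try rcases sa with sa | sa | sa) <;> (try rcases sb with sb | sb | sb) <;> omega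

lemma hx_stage1_step {n : ℕ} (j : ℕ) (hj : j < n) : hxEq (hxK1 n j) (hxK1 n (j + 1)) := by
  refine hx_moves (hxK1_down n j)
    {τ | ∃ a : Option (Fin n × Bool), hxCol (some (true, a) : hxM n) < hxTh (j + 1) ∧
      τ = {some (false, none), some (true, a)}} (some (false, some (⟨j, hj⟩, true))) ?_ ?_
  · rintro _ ⟨a, ha, rfl⟩
    refine ⟨by simp, by simp, ?_⟩
    intro σ hσ hs
    have hc : (some (false, none) : hxM n) ∈ σ := hs (by simp)
    have hx : (some (true, a) : hxM n) ∈ σ := hs (by simp)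
    refine ⟨hxK0_insert hσ.1 _ ?_, ?_⟩
    · intro b hb hyb
      rcases hx_arith1 ⟨j, hj⟩ a b hyb (hσ.2 hc a hx) ha
        (fun c h => by subst h; exact hσ.2 hc c hb) with h | h | h
      · exact hσ.1 _ hx _ hb h
      · exact hσ.1 _ hc _ hb h
      · exact hσ.1 _ hc _ hx h
    · intro _ b hb
      refine hσ.2 hc b ?_
      simpa using hb
  · intro σ
    constructor
    · intro h
      have hle : hxTh j ≤ hxTh (j + 1) := by
        have e : hxTh (j + 1) = 2 * j + 4 := rfl
        rw [e, hxTh_eq]; split_ifs <;> omega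
      refine ⟨⟨h.1, fun hc a ha => hle.trans (h.2 hc a ha)⟩, ?_⟩
      rintro _ ⟨a, ha, rfl⟩ hs
      have hc : (some (false, none) : hxM n) ∈ σ := hs (by simp)
      have hx : (some (true, a) : hxM n) ∈ σ := hs (by simp)
      exact absurd (h.2 hc a hx) (not_le.2 ha)
    · rintro ⟨h, h2⟩
      refine ⟨h.1, fun hc a ha => ?_⟩
      by_contra hcon
      refine h2 _ ⟨a, not_le.1 hcon, rfl⟩ ?_
      intro v hv
      simp only [Finset.coe_insert, Finset.coe_singleton, Set.mem_insert_iff,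
        Set.mem_singleton_iff] at hv
      rcases hv with rfl | rfl <;> assumption

lemma hx_stage1_end {n : ℕ} (hn : 1 ≤ n) {σ : Set (hxM n)} (h : hxK1 n n σ)
    (hc : (some (false, none) : hxM n) ∈ σ) (a : Option (Fin n × Bool)) :
    (some (true, a) : hxM n) ∉ σ := by
  intro ha
  have h1 := h.2 hc a ha
  have h2 := hxCol_lt hn (some (true, a))
  rw [hxTh_eq] at h1
  split_ifs at h1 <;> omega

lemma hx_stage2_step {n : ℕ} (hn : 1 ≤ n) (j : ℕ) (hj : j < n) :
    hxEq (hxK2 n j) (hxK2 n (j + 1)) := by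
  refine hx_moves (hxK2_down n j)
    {τ | ∃ a : Option (Fin n × Bool), hxCol (some (false, a) : hxM n) < hxTh (j + 1) ∧
      τ = {some (true, none), some (false, a)}} (some (true, some (⟨j, hj⟩, true))) ?_ ?_
  · rintro _ ⟨a, ha, rfl⟩
    refine ⟨by simp, by simp, ?_⟩
    intro σ hσ hs
    have hc : (some (true, none) : hxM n) ∈ σ := hs (by simp)
    have hx : (some (false, a) : hxM n) ∈ σ := hs (by simp)
    have hnc : (some (false, none) : hxM n) ∉ σ := fun h => hx_stage1_end hn hσ.1 h _ hc
    refine ⟨⟨hxK0_insert hσ.1.1 _ ?_, ?_⟩, ?_⟩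
    · intro b hb hyb
      rcases hx_arith2 ⟨j, hj⟩ a b hyb (fun h => by subst h; exact hnc hx) (hσ.2 hc a hx) ha
        (fun c h => by subst h; exact hσ.2 hc c hb) with h | h | h
      · exact hσ.1.1 _ hx _ hb h
      · exact hσ.1.1 _ hc _ hb h
      · exact hσ.1.1 _ hc _ hx h
    · intro h
      refine absurd ?_ hnc
      simpa using h
    · intro _ b hb
      refine hσ.2 hc b ?_
      simpa using hb
  · intro σ
    constructor
    · intro h
      have hle : hxTh j ≤ hxTh (j + 1) := by
        have e : hxTh (j + 1) = 2 * j + 4 := rfl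
        rw [e, hxTh_eq]; split_ifs <;> omega
      refine ⟨⟨h.1, fun hc a ha => hle.trans (h.2 hc a ha)⟩, ?_⟩
      rintro _ ⟨a, ha, rfl⟩ hs
      have hc : (some (true, none) : hxM n) ∈ σ := hs (by simp)
      have hx : (some (false, a) : hxM n) ∈ σ := hs (by simp)
      exact absurd (h.2 hc a hx) (not_le.2 ha)
    · rintro ⟨h, h2⟩
      refine ⟨h.1, fun hc a ha => ?_⟩
      by_contra hcon
      refine h2 _ ⟨a, not_le.1 hcon, rfl⟩ ?_
      intro v hv
      simp only [Finset.coe_insert, Finset.coe_singleton, Set.mem_insert_iff,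
        Set.mem_singleton_iff] at hv
      rcases hv with rfl | rfl <;> assumption

lemma hx_stage2_end {n : ℕ} (hn : 1 ≤ n) {σ : Set (hxM n)} (h : hxK2 n n σ)
    (hc : (some (true, none) : hxM n) ∈ σ) (a : Option (Fin n × Bool)) :
    (some (false, a) : hxM n) ∉ σ := by
  intro ha
  have h1 := h.2 hc a ha
  have h2 := hxCol_lt hn (some (false, a))
  rw [hxTh_eq] at h1
  split_ifs at h1 <;> omega

/-- The antipode-free, unmixed subsets: two cross-polytopes sharing one vertex. -/
def hxK3 (n : ℕ) (σ : Set (hxM n)) : Prop :=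
  ∃ s : Bool, (∀ a, some (!s, a) ∉ σ) ∧ ¬ (none ∈ σ ∧ some (s, none) ∈ σ) ∧
    ∀ i, ¬ (some (s, some (i, true)) ∈ σ ∧ some (s, some (i, false)) ∈ σ)

lemma hx_exT {n : ℕ} (i : Fin n) (t : Bool) :
    ((i : ℕ) = 0 ∧ hxRow (some (true, some (i, t))) = 1 ∧
      ((t = true ∧ hxCol (some (true, some (i, t))) = 1) ∨
        (t = false ∧ hxCol (some (true, some (i, t))) = 0))) ∨
    ((i : ℕ) ≠ 0 ∧ hxRow (some (true, some (i, t))) = (i : ℕ) % 2 ∧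
      ((t = true ∧ hxCol (some (true, some (i, t))) = 2 * (i : ℕ) + 1) ∨
        (t = false ∧ hxCol (some (true, some (i, t))) = 2 * (i : ℕ) + 2))) := by
  by_cases h : (i : ℕ) = 0 <;> cases t <;> simp [hxRow, hxCol, h]

lemma hx_exF {n : ℕ} (i : Fin n) (t : Bool) :
    hxRow (some (false, some (i, t))) = ((i : ℕ) + 1) % 2 ∧
      ((t = true ∧ hxCol (some (false, some (i, t))) = 2 * (i : ℕ) + 1) ∨
        (t = false ∧ hxCol (some (false, some (i, t))) = 2 * (i : ℕ) + 2)) := by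
  cases t <;> simp [hxRow, hxCol]

lemma hx_adjT {n : ℕ} (i k : Fin n) (t u : Bool)
    (h : hxAdj (some (true, some (i, t))) (some (true, some (k, u)))) : i = k ∧ u = !t := by
  have e1 := hx_exT i t
  have e2 := hx_exT k u
  unfold hxAdj at h
  rw [Fin.ext_iff]
  generalize hxRow (some (true, some (i, t))) = ra at *
  generalize hxCol (some (true, some (i, t))) = ca at *
  generalize hxRow (some (true, some (k, u))) = rb at *
  generalize hxCol (some (true, some (k, u))) = cb at *
  rcases e1 with ⟨h1, h2, ⟨rfl, h3⟩ | ⟨rfl, h3⟩⟩ | ⟨h1, h2, ⟨rfl, h3⟩ | ⟨rfl, h3⟩⟩ <;>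
  rcases e2 with ⟨g1, g2, ⟨rfl, g3⟩ | ⟨rfl, g3⟩⟩ | ⟨g1, g2, ⟨rfl, g3⟩ | ⟨rfl, g3⟩⟩ <;>
  simp <;> omega

lemma hx_adjF {n : ℕ} (i k : Fin n) (t u : Bool)
    (h : hxAdj (some (false, some (i, t))) (some (false, some (k, u)))) : i = k ∧ u = !t := by
  have e1 := hx_exF i t
  have e2 := hx_exF k u
  unfold hxAdj at h
  rw [Fin.ext_iff]
  generalize hxRow (some (false, some (i, t))) = ra at *
  generalize hxCol (some (false, some (i, t))) = ca at *
  generalize hxRow (some (false, some (k, u))) = rb at *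
  generalize hxCol (some (false, some (k, u))) = cb at *
  rcases e1 with ⟨h2, ⟨rfl, h3⟩ | ⟨rfl, h3⟩⟩ <;>
  rcases e2 with ⟨g2, ⟨rfl, g3⟩ | ⟨rfl, g3⟩⟩ <;>
  simp <;> omega

lemma hx_adjNone {n : ℕ} (s : Bool) (i : Fin n) (t : Bool) :
    ¬ hxAdj none (some (s, some (i, t))) ∧ ¬ hxAdj (some (s, none)) (some (s, some (i, t))) := by
  have e1 := hx_exT i t
  have e2 := hx_exF i t
  cases s <;> simp only [hxAdj, hxRow.eq_1, hxCol.eq_1, hxRow.eq_2, hxCol.eq_2, hxCol.eq_3] <;>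
    constructor <;> omega

lemma hx_side_adj {n : ℕ} (s : Bool) (a b : hxM n) (ha : ∀ c, a ≠ some (!s, c))
    (hb : ∀ c, b ≠ some (!s, c)) (hab : hxAdj a b) :
    (a = none ∧ b = some (s, none)) ∨ (b = none ∧ a = some (s, none)) ∨
    (∃ i t, a = some (s, some (i, t)) ∧ b = some (s, some (i, !t))) := by
  have hs : ∀ (s' : Bool), s' = s ∨ s' = !s := by cases s <;> simp
  rcases a with _ | ⟨s1, a⟩ <;> rcases b with _ | ⟨s2, b⟩
  · exact absurd hab (hxAdj_irrefl _)
  · rcases hs s2 with rfl | rfl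
    · rcases b with _ | ⟨i, t⟩
      · exact Or.inl ⟨rfl, rfl⟩
      · exact absurd hab (hx_adjNone _ i t).1
    · exact absurd rfl (hb _)
  · rcases hs s1 with rfl | rfl
    · rcases a with _ | ⟨i, t⟩
      · exact Or.inr (Or.inl ⟨rfl, rfl⟩)
      · exact absurd (hxAdj_symm hab) (hx_adjNone _ i t).1
    · exact absurd rfl (ha _)
  · rcases hs s1 with rfl | rfl
    swap
    · exact absurd rfl (ha _)
    rcases hs s2 with rfl | rfl
    swap
    · exact absurd rfl (hb _)
    rcases a with _ | ⟨i, t⟩ <;> rcases b with _ | ⟨k, u⟩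
    · exact absurd hab (hxAdj_irrefl _)
    · exact absurd hab (hx_adjNone _ k u).2
    · exact absurd (hxAdj_symm hab) (hx_adjNone _ i t).2
    · refine Or.inr (Or.inr ⟨i, t, rfl, ?_⟩)
      have : i = k ∧ u = !t := by
        cases s2
        · exact hx_adjF i k t u hab
        · exact hx_adjT i k t u hab
      rw [← this.1, this.2]

lemma hx_stage3 {n : ℕ} (hn : 1 ≤ n) : hxEq (hxK2 n n) (hxK3 n) := by
  refine hx_moves (hxK2_down n n)
    {τ | ∃ a b : Option (Fin n × Bool), τ = {some (true, a), some (false, b)}} none ?_ ?_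
  · rintro _ ⟨a, b, rfl⟩
    refine ⟨by simp, by simp, ?_⟩
    intro σ hσ hs
    have hx : (some (true, a) : hxM n) ∈ σ := hs (by simp)
    have hz : (some (false, b) : hxM n) ∈ σ := hs (by simp)
    have hna : (some (true, none) : hxM n) ∉ σ := fun h => hx_stage2_end hn hσ h _ hz
    have hnc : (some (false, none) : hxM n) ∉ σ := fun h => hx_stage1_end hn hσ.1 h _ hx
    refine ⟨⟨hxK0_insert hσ.1.1 _ ?_, ?_⟩, ?_⟩
    · intro c hc hyc
      rcases c with _ | ⟨s, c⟩
      · exact hxAdj_irrefl _ hyc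
      · have := hx_side_adj s none (some (s, c)) (by simp) (by simp) hyc
        simp at this
        subst this
        cases s
        · exact hnc hc
        · exact hna hc
    · intro h
      refine absurd ?_ hnc
      simpa using h
    · intro h
      refine absurd ?_ hna
      simpa using h
  · intro σ
    constructor
    · rintro ⟨s, h1, h2, h3⟩
      have hunmix : ∀ a b, (some (true, a) : hxM n) ∈ σ → (some (false, b) : hxM n) ∈ σ →
          False := by
        intro a b ha hb
        cases s
        · exact h1 _ ha
        · exact h1 _ hb
      refine ⟨⟨⟨?_, ?_⟩, ?_⟩, ?_⟩
      · intro a ha b hb hab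
        rcases hx_side_adj s a b (fun c h => h1 c (h ▸ ha)) (fun c h => h1 c (h ▸ hb)) hab with
          ⟨rfl, rfl⟩ | ⟨rfl, rfl⟩ | ⟨i, t, rfl, rfl⟩
        · exact h2 ⟨ha, hb⟩
        · exact h2 ⟨hb, ha⟩
        · cases t
          · exact h3 i ⟨hb, ha⟩
          · exact h3 i ⟨ha, hb⟩
      · intro hc a ha
        exact (hunmix _ _ ha hc).elim
      · intro hc a ha
        exact (hunmix _ _ hc ha).elim
      · rintro _ ⟨a, b, rfl⟩ hs
        exact hunmix a b (hs (by simp)) (hs (by simp))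
    · rintro ⟨hσ, h2⟩
      have hunmix : ∀ a b, (some (true, a) : hxM n) ∈ σ → (some (false, b) : hxM n) ∈ σ →
          False := by
        intro a b ha hb
        refine h2 _ ⟨a, b, rfl⟩ ?_
        intro v hv
        simp only [Finset.coe_insert, Finset.coe_singleton, Set.mem_insert_iff,
          Set.mem_singleton_iff] at hv
        rcases hv with rfl | rfl <;> assumption
      have hanti : ∀ s : Bool, ¬ (none ∈ σ ∧ (some (s, none) : hxM n) ∈ σ) ∧
          ∀ i, ¬ ((some (s, some (i, true)) : hxM n) ∈ σ ∧
            (some (s, some (i, false)) : hxM n) ∈ σ) := by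
        intro s
        constructor
        · rintro ⟨ha, hb⟩
          refine hσ.1.1 _ ha _ hb ?_
          cases s <;> simp [hxAdj, hxRow, hxCol]
        · rintro i ⟨ha, hb⟩
          refine hσ.1.1 _ ha _ hb ?_
          cases s <;> simp [hxAdj, hxRow, hxCol]
          split_ifs <;> omega
      by_cases h : ∃ a, (some (true, a) : hxM n) ∈ σ
      · obtain ⟨a, ha⟩ := h
        exact ⟨true, fun b hb => hunmix _ _ ha hb, hanti true⟩
      · exact ⟨false, fun b hb => h ⟨b, hb⟩, hanti false⟩

lemma hx_comb {n : ℕ} (hn : 1 ≤ n) : hxEq (isIndepSet (hexRow n)) (hxK3 n) := by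
  have hI : hxDown (isIndepSet (hexRow n)) := fun s t hst h => Set.Pairwise.mono hst h
  have e0 : hxEq (isIndepSet (hexRow n)) (hxK1 n 0) := by
    refine hxEq_trans (hx_pull hI (hxPi hn) (hxPi_surj hn)) (hxEq_of_iff ?_)
    intro σ
    rw [hxK0_iff hn]
    simp [hxK1, hxTh]
  have e1 : ∀ j, j ≤ n → hxEq (hxK1 n 0) (hxK1 n j) := by
    intro j
    induction j with
    | zero => intro _; exact hxEq_of_iff fun _ => Iff.rfl
    | succ j ih => intro hj; exact hxEq_trans (ih (by omega)) (hx_stage1_step j (by omega))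
  have e2 : ∀ j, j ≤ n → hxEq (hxK1 n n) (hxK2 n j) := by
    intro j
    induction j with
    | zero => intro _; exact hxEq_of_iff fun _ => by simp [hxK2, hxTh]
    | succ j ih => intro hj; exact hxEq_trans (ih (by omega)) (hx_stage2_step hn j (by omega))
  exact hxEq_trans e0 (hxEq_trans (e1 n le_rfl) (hxEq_trans (e2 n le_rfl) (hx_stage3 hn)))

lemma hx_indReal (n : ℕ) : indRealization (hexRow n) = hxReal (isIndepSet (hexRow n)) := by
  ext f
  simp only [indRealization, indRealizationIn, hxReal, Set.mem_ofPred_eq, finsum_eq_sum_of_fintype,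
    Set.subset_univ, true_and, Set.toFinite]
  tauto

/-- signs -/
noncomputable def hxSg (s : Bool) : ℝ := if s then 1 else -1

lemma hxSg_not (s : Bool) : hxSg (!s) = - hxSg s := by cases s <;> simp [hxSg]

lemma hxSg_sq (s : Bool) : hxSg s * hxSg s = 1 := by cases s <;> simp [hxSg]

/-- The (unnormalized) map from the wedge of two round spheres to two cross-polytopes. -/
noncomputable def hxA {n : ℕ} (x : ℝ) (z : Fin n → ℝ) : hxM n → ℝ
  | none => max (1 - |x|) 0
  | some (s, none) => max (hxSg s * x - 1) 0
  | some (s, some (i, t)) => min (max (hxSg t * z i) 0) (Real.sqrt (2 * (hxSg s * x)))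

/-- The normalizing factor. -/
noncomputable def hxD {n : ℕ} (x : ℝ) (z : Fin n → ℝ) : ℝ := abs (1 - |x|) + ∑ i, |z i|

/-- The same map, on one of the two sides. -/
noncomputable def hxB {n : ℕ} (s : Bool) (c : ℝ) (z : Fin n → ℝ) : hxM n → ℝ
  | none => max (1 - c) 0
  | some (u, none) => if u = s then max (c - 1) 0 else 0
  | some (u, some (i, t)) => if u = s then max (hxSg t * z i) 0 else 0

lemma hxA_eq {n : ℕ} (s : Bool) (c : ℝ) (hc : 0 ≤ c) (z : Fin n → ℝ)
    (h : (c - 1) ^ 2 + ∑ i, z i ^ 2 = 1) : hxA (hxSg s * c) z = hxB s c z := by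
  have habs : |hxSg s * c| = c := by
    rw [abs_mul, abs_of_nonneg hc]
    cases s <;> simp [hxSg]
  funext m
  rcases m with _ | ⟨u, _ | ⟨i, t⟩⟩
  · simp only [hxA, hxB, habs]
  · simp only [hxA, hxB]
    split_ifs with hu
    · subst hu
      rw [← mul_assoc, hxSg_sq, one_mul]
    · have : u = !s := by cases u <;> cases s <;> simp_all
      rw [this, hxSg_not, ← mul_assoc, neg_mul, hxSg_sq]
      apply max_eq_right
      linarith
  · simp only [hxA, hxB]
    split_ifs with hu
    · subst hu
      rw [← mul_assoc (hxSg u), hxSg_sq, one_mul]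
      apply min_eq_left
      have hz : z i ^ 2 ≤ 2 * c := by
        have := Finset.single_le_sum (f := fun i => z i ^ 2) (fun i _ => sq_nonneg _)
          (Finset.mem_univ i)
        nlinarith [sq_nonneg c]
      have hz' : |z i| ≤ Real.sqrt (2 * c) := Real.abs_le_sqrt hz
      refine max_le ?_ (Real.sqrt_nonneg _)
      refine le_trans (le_abs_self _) ?_
      rw [abs_mul]
      have : |hxSg t| = 1 := by cases t <;> simp [hxSg]
      rw [this, one_mul]
      exact hz'
    · have : u = !s := by cases u <;> cases s <;> simp_all
      rw [this, hxSg_not, ← mul_assoc (-hxSg s), neg_mul, hxSg_sq, Real.sqrt_eq_zero_of_nonpos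
        (by linarith)]
      exact min_eq_right (le_max_right _ _)

lemma hx_max_add (a : ℝ) : max a 0 + max (-a) 0 = |a| := by
  rcases le_total 0 a with h | h
  · rw [max_eq_left h, max_eq_right (by linarith), abs_of_nonneg h]; ring
  · rw [max_eq_right h, max_eq_left (by linarith), abs_of_nonpos h]; ring

lemma hx_max_sub (a : ℝ) : max a 0 - max (-a) 0 = a := by
  rcases le_total 0 a with h | h
  · rw [max_eq_left h, max_eq_right (by linarith)]; ring
  · rw [max_eq_right h, max_eq_left (by linarith)]; ring

lemma hxB_sum {n : ℕ} (s : Bool) (c : ℝ) (hc : 0 ≤ c) (z : Fin n → ℝ) :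
    ∑ m, hxB s c z m = hxD c z := by
  simp only [Fintype.sum_option, Fintype.sum_prod_type, Fintype.sum_bool, hxB, hxD]
  rw [abs_of_nonneg hc, ← hx_max_add (1 - c), neg_sub]
  have : ∀ i, |z i| = max (z i) 0 + max (-z i) 0 := fun i => (hx_max_add _).symm
  simp only [this]
  cases s <;> simp [hxSg] <;> ring

lemma hxB_nonneg {n : ℕ} (s : Bool) (c : ℝ) (z : Fin n → ℝ) (m : hxM n) : 0 ≤ hxB s c z m := by
  rcases m with _ | ⟨u, _ | ⟨i, t⟩⟩ <;> simp only [hxB] <;> (try split_ifs) <;>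
    first | exact le_max_right _ _ | exact le_rfl

lemma hxD_pos {n : ℕ} (c : ℝ) (hc : 0 ≤ c) (z : Fin n → ℝ)
    (h : (c - 1) ^ 2 + ∑ i, z i ^ 2 = 1) : 0 < hxD c z := by
  have h0 : 0 ≤ ∑ i, |z i| := Finset.sum_nonneg fun i _ => abs_nonneg _
  have h1 : 0 ≤ abs (1 - |c|) := abs_nonneg _
  refine lt_of_le_of_ne (add_nonneg h1 h0) fun hz => ?_
  have e1 : abs (1 - |c|) = 0 := by unfold hxD at hz; linarith
  have e2 : ∑ i, |z i| = 0 := by unfold hxD at hz; linarith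
  rw [abs_of_nonneg hc, abs_eq_zero] at e1
  rw [Finset.sum_eq_zero_iff_of_nonneg (fun i _ => abs_nonneg _)] at e2
  have e3 : ∑ i, z i ^ 2 = 0 := Finset.sum_eq_zero fun i hi => by
    rw [abs_eq_zero.1 (e2 i hi)]; simp
  rw [e3] at h
  have : c - 1 = 0 := by linarith
  rw [this] at h
  norm_num at h

lemma hxB_face {n : ℕ} (s : Bool) (c : ℝ) (z : Fin n → ℝ) (d : ℝ) :
    hxK3 n (Function.support fun m => hxB s c z m / d) := by
  have key : ∀ m, m ∈ (Function.support fun m => hxB s c z m / d) → hxB s c z m ≠ 0 := by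
    intro m hm h0
    apply hm
    simp [h0]
  refine ⟨s, ?_, ?_, ?_⟩
  · intro a ha
    apply key _ ha
    rcases a with _ | ⟨i, t⟩ <;> simp [hxB]
  · rintro ⟨h1, h2⟩
    have h1 := key _ h1
    have h2 := key _ h2
    simp only [hxB, if_true] at h1 h2
    rcases le_total c 1 with h | h
    · exact h2 (max_eq_right (by linarith))
    · exact h1 (max_eq_right (by linarith))
  · rintro i ⟨h1, h2⟩
    have h1 := key _ h1
    have h2 := key _ h2
    simp only [hxB, hxSg, if_true] at h1 h2
    rcases le_total (z i) 0 with h | h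
    · exact h1 (max_eq_right (by simpa using h))
    · exact h2 (max_eq_right (by simpa using h))

lemma hx_wedge_iff {n : ℕ} (x : EuclideanSpace ℝ (Fin (n + 1))) :
    x ∈ sphereWedge n ↔ (|x 0| - 1) ^ 2 + ∑ i : Fin n, x i.succ ^ 2 = 1 := by
  have h1 : dist x (EuclideanSpace.single (0 : Fin (n + 1)) (1 : ℝ)) = 1 ↔
      (x 0 - 1) ^ 2 + ∑ i : Fin n, x i.succ ^ 2 = 1 := by
    rw [EuclideanSpace.dist_eq, Real.sqrt_eq_one, Fin.sum_univ_succ]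
    simp [Real.dist_eq]
  have h2 : dist x (-EuclideanSpace.single (0 : Fin (n + 1)) (1 : ℝ)) = 1 ↔
      (x 0 + 1) ^ 2 + ∑ i : Fin n, x i.succ ^ 2 = 1 := by
    rw [EuclideanSpace.dist_eq, Real.sqrt_eq_one, Fin.sum_univ_succ]
    simp [Real.dist_eq]
  have hs : 0 ≤ ∑ i : Fin n, x i.succ ^ 2 := Finset.sum_nonneg fun i _ => sq_nonneg _
  change _ ∨ _ ↔ _
  rw [h1, h2]
  generalize ∑ i : Fin n, x i.succ ^ 2 = S at *
  rcases le_total 0 (x 0) with h | h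
  · rw [abs_of_nonneg h]
    constructor
    · rintro (h' | h')
      · exact h'
      · nlinarith
    · exact Or.inl
  · rw [abs_of_nonpos h]
    constructor
    · rintro (h' | h')
      · nlinarith
      · have e : (-x 0 - 1) ^ 2 = (x 0 + 1) ^ 2 := by ring
        linarith
    · intro h'
      right
      have e : (-x 0 - 1) ^ 2 = (x 0 + 1) ^ 2 := by ring
      linarith

lemma hx_decomp (x : ℝ) : ∃ s : Bool, x = hxSg s * |x| := by
  rcases le_total 0 x with h | h
  · exact ⟨true, by simp [hxSg, abs_of_nonneg h]⟩
  · exact ⟨false, by simp [hxSg, abs_of_nonpos h]⟩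

lemma hx_mem {n : ℕ} (x : ℝ) (z : Fin n → ℝ) (h : (|x| - 1) ^ 2 + ∑ i, z i ^ 2 = 1) :
    (fun m => hxA x z m / hxD x z) ∈ hxReal (hxK3 n) := by
  obtain ⟨s, hs⟩ := hx_decomp x
  have e1 : hxA x z = hxB s |x| z := by
    conv_lhs => rw [hs]
    exact hxA_eq s _ (abs_nonneg _) z h
  have e2 : hxD x z = hxD |x| z := by simp [hxD]
  have e3 := hxD_pos |x| (abs_nonneg _) z h
  rw [e1, e2]
  refine ⟨fun m => div_nonneg (hxB_nonneg _ _ _ _) e3.le, ?_, hxB_face _ _ _ _⟩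
  rw [← Finset.sum_div, hxB_sum s _ (abs_nonneg _), div_self e3.ne']

/-- Injectivity, on recovered data. -/
lemma hx_inj {n : ℕ} (x x' : ℝ) (z z' : Fin n → ℝ) (h : (|x| - 1) ^ 2 + ∑ i, z i ^ 2 = 1)
    (h' : (|x'| - 1) ^ 2 + ∑ i, z' i ^ 2 = 1)
    (hA : (fun m => hxA x z m / hxD x z) = (fun m => hxA x' z' m / hxD x' z')) :
    x = x' ∧ z = z' := by
  obtain ⟨s, hs⟩ := hx_decomp x
  obtain ⟨s', hs'⟩ := hx_decomp x'
  have e1 : hxA x z = hxB s |x| z := by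
    conv_lhs => rw [hs]
    exact hxA_eq s _ (abs_nonneg _) z h
  have e1' : hxA x' z' = hxB s' |x'| z' := by
    conv_lhs => rw [hs']
    exact hxA_eq s' _ (abs_nonneg _) z' h'
  have e3 := hxD_pos |x| (abs_nonneg _) z h
  have e3' := hxD_pos |x'| (abs_nonneg _) z' h'
  have e2 : hxD x z = hxD |x| z := by simp [hxD]
  have e2' : hxD x' z' = hxD |x'| z' := by simp [hxD]
  rw [e1, e1', e2, e2'] at hA
  generalize hxD |x| z = d at *
  generalize hxD |x'| z' = d' at *
  have hc := abs_nonneg x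
  have hc' := abs_nonneg x'
  rw [hs, hs']
  generalize |x| = c at *
  generalize |x'| = c' at *
  have hm := fun m => congrFun hA m
  -- combine
  have w0 : ∀ (s : Bool) (c : ℝ) (z : Fin n → ℝ) (d : ℝ), hxB s c z none / d -
      (hxB s c z (some (true, none)) / d + hxB s c z (some (false, none)) / d) = (1 - c) / d := by
    intro s c z d
    rw [← hx_max_sub (1 - c), neg_sub]
    cases s <;> simp [hxB] <;> ring
  have wi : ∀ (s : Bool) (c : ℝ) (z : Fin n → ℝ) (d : ℝ) (i : Fin n),
      (hxB s c z (some (true, some (i, true))) / d + hxB s c z (some (false, some (i, true))) / d) -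
      (hxB s c z (some (true, some (i, false))) / d + hxB s c z (some (false, some (i, false))) / d)
       = z i / d := by
    intro s c z d i
    have e := hx_max_sub (z i)
    cases s <;> simp [hxB, hxSg] <;> rw [← sub_div, e]
  have k0 : (1 - c) / d = (1 - c') / d' := by
    rw [← w0 s c z d, ← w0 s' c' z' d', hm, hm, hm]
  have ki : ∀ i, z i / d = z' i / d' := by
    intro i
    rw [← wi s c z d, ← wi s' c' z' d', hm, hm, hm, hm]
  have kd : d = d' := by
    have q1 : ((1 - c) / d) ^ 2 + ∑ i, (z i / d) ^ 2 = (1 / d) ^ 2 := by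
      simp only [div_pow]
      rw [← Finset.sum_div, ← add_div]
      congr 1
      linarith
    have q2 : ((1 - c') / d') ^ 2 + ∑ i, (z' i / d') ^ 2 = (1 / d') ^ 2 := by
      simp only [div_pow]
      rw [← Finset.sum_div, ← add_div]
      congr 1
      linarith
    have q3 : (1 / d) ^ 2 = (1 / d') ^ 2 := by
      rw [← q1, ← q2, k0]
      simp only [ki]
    have q4 := (sq_eq_sq₀ (by positivity) (by positivity)).1 q3
    simpa using q4
  subst kd
  have kc : c = c' := by
    rw [div_left_inj' e3.ne'] at k0
    linarith
  have kz : z = z' := by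
    funext i
    have := ki i
    rwa [div_left_inj' e3.ne'] at this
  subst kc kz
  refine ⟨?_, rfl⟩
  by_cases hss : s = s'
  · rw [hss]
  · have hc0 : c = 0 := by
      have z0 : ∀ i, z i = 0 := by
        intro i
        have a1 := hm (some (s, some (i, true)))
        have a2 := hm (some (s, some (i, false)))
        rw [div_left_inj' e3.ne'] at a1 a2
        simp only [hxB, if_true, if_neg hss, hxSg] at a1 a2
        have := hx_max_sub (z i)
        simp at a1 a2
        linarith
      have a3 := hm (some (s, none))
      rw [div_left_inj' e3.ne'] at a3
      simp only [hxB, if_true, if_neg hss] at a3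
      have a4 : c - 1 ≤ 0 := a3 ▸ le_max_left _ _
      simp only [z0] at h
      simp at h
      rcases h with h | h <;> linarith
    rw [hc0]; simp

lemma hx_surj {n : ℕ} (f : hxM n → ℝ) (hf : f ∈ hxReal (hxK3 n)) :
    ∃ (x : ℝ) (z : Fin n → ℝ), (|x| - 1) ^ 2 + ∑ i, z i ^ 2 = 1 ∧
      (fun m => hxA x z m / hxD x z) = f := by
  obtain ⟨h0, hsum, s, h1, h2, h3⟩ := hf
  simp only [Function.mem_support, not_not] at h1
  have pm : ∀ a b : ℝ, 0 ≤ a → 0 ≤ b → ¬ (a ≠ 0 ∧ b ≠ 0) →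
      max (a - b) 0 = a ∧ max (b - a) 0 = b ∧ |a - b| = a + b := by
    intro a b ha hb hab
    by_cases h : a = 0
    · subst h
      simp [hb, abs_of_nonneg hb]
    · have : b = 0 := by by_contra h'; exact hab ⟨h, h'⟩
      subst this
      simp [ha, abs_of_nonneg ha]
  obtain ⟨w0, hw0⟩ : ∃ w0, w0 = f none - f (some (s, none)) := ⟨_, rfl⟩
  obtain ⟨w, hw⟩ : ∃ w : Fin n → ℝ, w = fun i => f (some (s, some (i, true))) -
    f (some (s, some (i, false))) := ⟨_, rfl⟩
  have p0 := pm _ _ (h0 none) (h0 (some (s, none))) h2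
  have pi := fun i => pm _ _ (h0 (some (s, some (i, true)))) (h0 (some (s, some (i, false)))) (h3 i)
  have hone : |w0| + ∑ i, |w i| = 1 := by
    rw [hw0, hw, p0.2.2]
    simp only [fun i => (pi i).2.2]
    rw [← hsum]
    simp only [Fintype.sum_option, Fintype.sum_prod_type, Fintype.sum_bool]
    cases s
    · simp only [Bool.not_false] at h1
      simp [h1]; ring
    · simp only [Bool.not_true] at h1
      simp [h1]; ring
  obtain ⟨N, hN⟩ : ∃ N, N = Real.sqrt (w0 ^ 2 + ∑ i, w i ^ 2) := ⟨_, rfl⟩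
  have hS : 0 ≤ ∑ i, w i ^ 2 := Finset.sum_nonneg fun i _ => sq_nonneg _
  have hNN : N ^ 2 = w0 ^ 2 + ∑ i, w i ^ 2 := by
    rw [hN, Real.sq_sqrt]; positivity
  have hNpos : 0 < N := by
    refine lt_of_le_of_ne (hN ▸ Real.sqrt_nonneg _) fun hz => ?_
    rw [← hz] at hNN
    have e1 : w0 = 0 := by
      have : w0 ^ 2 = 0 := by nlinarith [sq_nonneg w0]
      simpa using this
    have e2 : ∑ i, w i ^ 2 = 0 := by nlinarith [sq_nonneg w0]
    rw [Finset.sum_eq_zero_iff_of_nonneg (fun i _ => sq_nonneg _)] at e2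
    have e3 : ∀ i, w i = 0 := fun i => by simpa using e2 i (Finset.mem_univ i)
    simp [e1, e3] at hone
  have hwN : w0 ≤ N := by
    rw [hN]
    exact Real.le_sqrt_of_sq_le (by linarith)
  have hc : 0 ≤ 1 - w0 / N := by
    rw [sub_nonneg, div_le_one hNpos]; exact hwN
  have heq : (1 - w0 / N - 1) ^ 2 + ∑ i, (w i / N) ^ 2 = 1 := by
    simp only [div_pow]
    rw [← Finset.sum_div]
    have : N ^ 2 ≠ 0 := by positivity
    rw [show (1 - w0 / N - 1) ^ 2 = w0 ^ 2 / N ^ 2 by rw [← div_pow]; ring, ← add_div, ← hNN,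
      div_self this]
  have habs : |hxSg s * (1 - w0 / N)| = 1 - w0 / N := by
    rw [abs_mul, abs_of_nonneg hc]
    cases s <;> simp [hxSg]
  have hD : hxD (hxSg s * (1 - w0 / N)) (fun i => w i / N) = 1 / N := by
    unfold hxD
    rw [habs, show 1 - (1 - w0 / N) = w0 / N by ring]
    simp only [abs_div, abs_of_pos hNpos]
    rw [← Finset.sum_div, ← add_div, hone]
  refine ⟨hxSg s * (1 - w0 / N), fun i => w i / N, by rw [habs]; exact heq, ?_⟩
  rw [hD, hxA_eq s _ hc _ heq]
  have mx : ∀ a : ℝ, max (a / N) 0 / (1 / N) = max a 0 := by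
    intro a
    have : max (a / N) 0 = max a 0 / N := by
      rw [max_div_div_right hNpos.le a 0 |>.symm, zero_div]
    rw [this]
    field_simp
  have hns : ∀ u, u ≠ s → u = !s := by intro u hu; cases u <;> cases s <;> simp_all
  funext m
  rcases m with _ | ⟨u, _ | ⟨i, t⟩⟩ <;> simp only [hxB]
  · rw [show 1 - (1 - w0 / N) = w0 / N by ring, mx, hw0, p0.1]
  · split_ifs with hu
    · subst hu
      rw [show 1 - w0 / N - 1 = (-w0) / N by ring, mx, hw0, neg_sub, p0.2.1]
    · rw [hns u hu, h1, zero_div]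
  · split_ifs with hu
    · subst hu
      rw [← mul_div_assoc, mx, hw]
      cases t
      · simp [hxSg, (pi i).2.1]
      · simp [hxSg, (pi i).1]
    · rw [hns u hu, h1, zero_div]

lemma hx_homeo (n : ℕ) : Nonempty (↥(sphereWedge n) ≃ₜ ↥(hxReal (hxK3 n))) := by
  have hcomp : IsCompact (sphereWedge n) :=
    (isCompact_sphere (EuclideanSpace.single (0 : Fin (n + 1)) (1 : ℝ)) 1).union
      (isCompact_sphere (-(EuclideanSpace.single (0 : Fin (n + 1)) (1 : ℝ))) 1)
  have : CompactSpace ↥(sphereWedge n) := isCompact_iff_compactSpace.1 hcomp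
  let Φ : ↥(sphereWedge n) → ↥(hxReal (hxK3 n)) := fun x =>
    ⟨fun m => hxA (x.1 0) (fun i => x.1 i.succ) m / hxD (x.1 0) (fun i => x.1 i.succ),
      hx_mem _ _ ((hx_wedge_iff _).1 x.2)⟩
  have hcoord : ∀ i, Continuous fun x : ↥(sphereWedge n) => x.1 i := fun i =>
    (EuclideanSpace.proj (𝕜 := ℝ) i).continuous.comp continuous_subtype_val
  have hcont : Continuous Φ := by
    refine Continuous.subtype_mk (continuous_pi fun m => ?_) _
    refine Continuous.div ?_ ?_ ?_
    · rcases m with _ | ⟨u, _ | ⟨i, t⟩⟩ <;> simp only [hxA]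
      · exact (continuous_const.sub (hcoord 0).abs).max continuous_const
      · exact ((continuous_const.mul (hcoord 0)).sub continuous_const).max continuous_const
      · exact ((continuous_const.mul (hcoord i.succ)).max continuous_const).min
          (Real.continuous_sqrt.comp (continuous_const.mul (continuous_const.mul (hcoord 0))))
    · unfold hxD
      exact (continuous_const.sub (hcoord 0).abs).abs.add
        (continuous_finsetSum _ fun (i : Fin n) _ => (hcoord (Fin.succ i)).abs)
    · intro x
      have := hxD_pos |x.1 0| (abs_nonneg _) (fun i => x.1 i.succ) ((hx_wedge_iff _).1 x.2)
      have e2 : hxD (x.1 0) (fun i => x.1 i.succ) = hxD |x.1 0| (fun i => x.1 i.succ) := by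
        simp [hxD]
      rw [e2]
      exact this.ne'
  have hbij : Function.Bijective Φ := by
    constructor
    · intro x y hxy
      have h := congrArg Subtype.val hxy
      obtain ⟨e1, e2⟩ := hx_inj _ _ _ _ ((hx_wedge_iff _).1 x.2) ((hx_wedge_iff _).1 y.2) h
      apply Subtype.ext
      ext i
      refine Fin.cases e1 (fun i => congrFun e2 i) i
    · intro f
      obtain ⟨x, z, h, hf⟩ := hx_surj f.1 f.2
      refine ⟨⟨WithLp.toLp 2 (Fin.cons x z), (hx_wedge_iff _).2 (by simpa using h)⟩, ?_⟩
      apply Subtype.ext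
      rw [← hf]
      simp [Φ]
  exact ⟨Continuous.homeoOfEquivCompactToT2 (f := Equiv.ofBijective Φ hbij) hcont⟩

end HexAux

/-- for `n ≥ 1`, `Ind (H_{1×1×n}) ≃ S^n ∨ S^n`. -/
theorem ind_hexRow (n : ℕ) (hn : 1 ≤ n) :
    Nonempty (ContinuousMap.HomotopyEquiv
      (↥(indRealization (hexRow n))) (↥(sphereWedge n))) := by
  obtain ⟨e⟩ := hx_homeo n
  rw [hx_indReal n]
  obtain ⟨h⟩ := hx_comb hn
  exact ⟨h.trans e.symm.toHomotopyEquiv⟩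
end

section
/- For n ≥ 2, the independence complex of X_n^{(1)} is homotopy equivalent to the double suspension of the independence complex of X_{n-1}^{(2)}: Ind(X_n^{(1)}) ≃ Σ²(Ind(X_{n-1}^{(2)})). -/
open Function Set

section Helpers
open Classical

theorem mem_ind_iff {V : Type*} [Fintype V] (G : SimpleGraph V) (S : Set V) (f : V → ℝ) :
    f ∈ indRealizationIn G S ↔ (∀ v, 0 ≤ f v) ∧ (∀ v, v ∉ S → f v = 0) ∧
      (∀ a b, G.Adj a b → f a * f b = 0) ∧ ∑ v, f v = 1 := by
  unfold indRealizationIn isIndepSet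
  simp only [Set.mem_ofPred_eq, finsum_eq_sum_of_fintype]
  constructor
  · rintro ⟨h0, -, hS, hI, h1⟩
    refine ⟨h0, fun v hv => ?_, fun a b hab => ?_, h1⟩
    · by_contra h
      exact hv (hS h)
    · by_contra h
      have h2 := mul_ne_zero_iff.1 h
      exact hI h2.1 h2.2 hab.ne hab
  · rintro ⟨h0, hS, hI, h1⟩
    refine ⟨h0, Set.toFinite _, fun v hv => ?_, fun a ha b hb _ hadj => ?_, h1⟩
    · by_contra h
      exact hv (hS v h)
    · exact mul_ne_zero ha hb (hI a b hadj)

theorem ind_compact {V : Type*} [Fintype V] (G : SimpleGraph V) (S : Set V) :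
    CompactSpace (indRealizationIn G S) := by
  rw [← isCompact_iff_compactSpace]
  have hsub : indRealizationIn G S ⊆ Set.Icc (0 : V → ℝ) 1 := by
    intro f hf
    rw [mem_ind_iff] at hf
    refine ⟨fun v => hf.1 v, fun v => ?_⟩
    have := Finset.single_le_sum (f := f) (fun i _ => hf.1 i) (Finset.mem_univ v)
    rw [hf.2.2.2] at this
    exact this
  refine IsCompact.of_isClosed_subset isCompact_Icc ?_ hsub
  have : indRealizationIn G S = {f | (∀ v, 0 ≤ f v) ∧ (∀ v, v ∉ S → f v = 0) ∧
      (∀ a b, G.Adj a b → f a * f b = 0) ∧ ∑ v, f v = 1} := by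
    ext f; exact mem_ind_iff G S f
  rw [this]
  simp only [Set.ofPred_and, Set.ofPred_forall]
  refine IsClosed.inter ?_ (IsClosed.inter ?_ (IsClosed.inter ?_ ?_))
  · exact isClosed_iInter fun v => isClosed_le (by fun_prop) (by fun_prop)
  · exact isClosed_iInter fun v => isClosed_iInter fun _ => isClosed_eq (by fun_prop) (by fun_prop)
  · exact isClosed_iInter fun v => isClosed_iInter fun _ => isClosed_iInter fun _ =>
      isClosed_eq (by fun_prop) (by fun_prop)
  · exact isClosed_eq (by fun_prop) (by fun_prop)

/-- move a fraction `t` of the weight at `u` to `w`. -/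
noncomputable def foldFun {V : Type*} (u w : V) (t : ℝ) (f : V → ℝ) : V → ℝ :=
  fun v => f v + t * f u * ((if v = w then 1 else 0) - (if v = u then 1 else 0))

theorem foldFun_mem {V : Type*} [Fintype V] (G : SimpleGraph V) (S : Set V) (u w : V)
    (hw : w ∈ S) (huw : u ≠ w) (hnadj : ¬ G.Adj u w)
    (hN : ∀ x ∈ S, G.Adj w x → G.Adj u x) (t : ℝ) (ht0 : 0 ≤ t) (ht1 : t ≤ 1)
    (f : V → ℝ) (hf : f ∈ indRealizationIn G S) :
    foldFun u w t f ∈ indRealizationIn G S := by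
  rw [mem_ind_iff] at hf ⊢
  obtain ⟨h0, hS, hI, h1⟩ := hf
  have key : ∀ x, G.Adj w x → f u * f x = 0 := by
    intro x hx
    by_cases hxS : x ∈ S
    · exact hI _ _ (hN x hxS hx)
    · rw [hS x hxS, mul_zero]
  have hoth : ∀ v, v ≠ u → v ≠ w → foldFun u w t f v = f v := by
    intro v h1 h2; simp [foldFun, h1, h2]
  have hu : foldFun u w t f u = (1 - t) * f u := by
    simp [foldFun, huw]; ring
  have hww : foldFun u w t f w = f w + t * f u := by
    simp [foldFun, huw.symm]
  have hpair : ∀ a b, a ≠ w → G.Adj a b → foldFun u w t f a * foldFun u w t f b = 0 := by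
    intro a b ha hab
    have hfab := hI a b hab
    by_cases hb : b = w
    · subst hb
      have hau : a ≠ u := by rintro rfl; exact hnadj hab
      rw [hoth a hau ha, hww]
      have := key a hab.symm
      linear_combination hfab + t * this
    · by_cases ha' : a = u
      · subst ha'
        have : b ≠ a := hab.ne'
        rw [hu, hoth b this hb]
        linear_combination (1 - t) * hfab
      · rw [hoth a ha' ha]
        by_cases hb' : b = u
        · subst hb'
          rw [hu]; linear_combination (1 - t) * hfab
        · rw [hoth b hb' hb]; exact hfab
  refine ⟨fun v => ?_, fun v hv => ?_, fun a b hab => ?_, ?_⟩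
  · by_cases hv : v = u
    · subst hv; rw [hu]; exact mul_nonneg (by linarith) (h0 _)
    · by_cases hv' : v = w
      · subst hv'; rw [hww]; have := h0 v; have := mul_nonneg ht0 (h0 u); linarith
      · rw [hoth v hv hv']; exact h0 v
  · have hv' : v ≠ w := by rintro rfl; exact hv hw
    by_cases hvu : v = u
    · subst hvu; rw [hu, hS _ hv, mul_zero]
    · rw [hoth v hvu hv', hS _ hv]
  · by_cases ha : a = w
    · have hb : b ≠ w := by rintro rfl; exact hab.ne ha
      rw [mul_comm]; exact hpair b a hb hab.symm
    · exact hpair a b ha hab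
  · unfold foldFun
    rw [Finset.sum_add_distrib, ← Finset.mul_sum, Finset.sum_sub_distrib, h1]
    simp

theorem ind_mono {V : Type*} [Fintype V] (G : SimpleGraph V) {S T : Set V} (h : S ⊆ T) :
    indRealizationIn G S ⊆ indRealizationIn G T := by
  intro f hf
  rw [mem_ind_iff] at hf ⊢
  exact ⟨hf.1, fun v hv => hf.2.1 v (fun h' => hv (h h')), hf.2.2⟩

theorem ind_fold {V : Type*} [Fintype V] (G : SimpleGraph V) (S : Set V) (u w : V)
    (hw : w ∈ S) (huw : u ≠ w) (hnadj : ¬ G.Adj u w)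
    (hN : ∀ x ∈ S, G.Adj w x → G.Adj u x) :
    Nonempty (ContinuousMap.HomotopyEquiv (indRealizationIn G S)
      (indRealizationIn G (S \ {u}))) := by
  have hcont : Continuous fun p : ℝ × (V → ℝ) => foldFun u w p.1 p.2 := by
    unfold foldFun
    fun_prop
  let r : C(indRealizationIn G S, indRealizationIn G (S \ {u})) :=
    ⟨fun f => ⟨foldFun u w 1 f.1, by
      have := foldFun_mem G S u w hw huw hnadj hN 1 zero_le_one le_rfl f.1 f.2
      rw [mem_ind_iff] at this ⊢
      refine ⟨this.1, fun v hv => ?_, this.2.2⟩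
      by_cases hvu : v = u
      · subst hvu; simp [foldFun, huw]
      · exact this.2.1 v (fun h => hv ⟨h, hvu⟩)⟩, by
      refine Continuous.subtype_mk ?_ _
      exact hcont.comp (continuous_const.prodMk continuous_subtype_val)⟩
  let i : C(indRealizationIn G (S \ {u}), indRealizationIn G S) :=
    ⟨fun f => ⟨f.1, ind_mono G Set.sdiff_subset f.2⟩, by fun_prop⟩
  refine ⟨⟨r, i, ⟨ContinuousMap.Homotopy.symm ?_⟩, ?_⟩⟩
  · exact
    { toFun := fun p => ⟨foldFun u w p.1 p.2.1,
        foldFun_mem G S u w hw huw hnadj hN p.1 p.1.2.1 p.1.2.2 p.2.1 p.2.2⟩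
      continuous_toFun := by
        refine Continuous.subtype_mk ?_ _
        exact hcont.comp (by fun_prop : Continuous fun p : unitInterval × indRealizationIn G S =>
          ((p.1 : ℝ), (p.2 : V → ℝ)))
      map_zero_left := by
        intro f; apply Subtype.ext; funext v; simp [foldFun]
      map_one_left := by
        intro f; apply Subtype.ext; funext v; simp [foldFun, r, i] }
  · have : r.comp i = ContinuousMap.id _ := by
      ext f : 1
      apply Subtype.ext
      have hfu : f.1 u = 0 := ((mem_ind_iff _ _ _).1 f.2).2.1 u (by simp)
      funext v
      simp [r, i, foldFun, hfu]
    rw [this]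

/-- the suspension parametrization -/
noncomputable def suspFun {V : Type*} (a b : V) (x : V → ℝ) (t : ℝ) : V → ℝ :=
  fun v => (1 - |2 * t - 1|) * x v + max 0 (1 - 2 * t) * (if v = a then 1 else 0)
    + max 0 (2 * t - 1) * (if v = b then 1 else 0)

theorem susp_homeo {V : Type*} [Fintype V] (G : SimpleGraph V) (A S : Set V) (a b : V)
    (hS : S = insert a (insert b A)) (hab : G.Adj a b) (haA : a ∉ A) (hbA : b ∉ A)
    (hna : ∀ x ∈ A, ¬ G.Adj a x) (hnb : ∀ x ∈ A, ¬ G.Adj b x)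
    (hne : A.Nonempty) :
    Nonempty (Susp (indRealizationIn G A) ≃ₜ indRealizationIn G S) := by
  have hne' : a ≠ b := hab.ne
  have habs : ∀ t : ℝ, |2 * t - 1| = max 0 (1 - 2 * t) + max 0 (2 * t - 1) := by
    intro t
    rcases le_total (2 * t) 1 with h | h
    · rw [abs_of_nonpos (by linarith), max_eq_right (by linarith), max_eq_left (by linarith)]; ring
    · rw [abs_of_nonneg (by linarith), max_eq_left (by linarith), max_eq_right (by linarith)]; ring
  have hmm : ∀ t : ℝ, max 0 (1 - 2 * t) * max 0 (2 * t - 1) = 0 := by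
    intro t
    rcases le_total (2 * t) 1 with h | h
    · rw [max_eq_left (b := 2 * t - 1) (by linarith), mul_zero]
    · rw [max_eq_left (b := 1 - 2 * t) (by linarith), zero_mul]
  have hs0 : ∀ t : unitInterval, 0 ≤ 1 - |2 * (t : ℝ) - 1| := by
    intro t
    have := t.2.1; have := t.2.2
    have : |2 * (t : ℝ) - 1| ≤ 1 := abs_le.2 ⟨by linarith, by linarith⟩
    linarith
  have xa : ∀ x ∈ indRealizationIn G A, x a = 0 := fun x hx => ((mem_ind_iff _ _ _).1 hx).2.1 a haA
  have xb : ∀ x ∈ indRealizationIn G A, x b = 0 := fun x hx => ((mem_ind_iff _ _ _).1 hx).2.1 b hbA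
  have va : ∀ x ∈ indRealizationIn G A, ∀ t, suspFun a b x t a = max 0 (1 - 2 * t) := by
    intro x hx t; simp [suspFun, xa x hx, hne']
  have vb : ∀ x ∈ indRealizationIn G A, ∀ t, suspFun a b x t b = max 0 (2 * t - 1) := by
    intro x hx t; simp [suspFun, xb x hx, hne'.symm]
  have vo : ∀ x t v, v ≠ a → v ≠ b → suspFun a b x t v = (1 - |2 * t - 1|) * x v := by
    intro x t v h1 h2; simp [suspFun, h1, h2]
  have hmem : ∀ p : indRealizationIn G A × unitInterval,
      suspFun a b p.1.1 p.2 ∈ indRealizationIn G S := by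
    rintro ⟨⟨x, hx⟩, t⟩
    have hxa := va x hx t
    have hxb := vb x hx t
    obtain ⟨h0, hA, hI, h1⟩ := (mem_ind_iff _ _ _).1 hx
    rw [mem_ind_iff]
    have hfa : ∀ v, G.Adj a v → v ≠ b → suspFun a b x t v = 0 := by
      intro v hv hvb
      rw [vo x t v hv.ne' hvb, hA v (fun h => hna v h hv), mul_zero]
    have hfb : ∀ v, G.Adj b v → v ≠ a → suspFun a b x t v = 0 := by
      intro v hv hva
      rw [vo x t v hva hv.ne', hA v (fun h => hnb v h hv), mul_zero]
    refine ⟨fun v => ?_, fun v hv => ?_, fun c d hcd => ?_, ?_⟩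
    · have := mul_nonneg (hs0 t) (h0 v)
      simp only [suspFun]
      positivity
    · subst hS
      simp only [Set.mem_insert_iff, not_or] at hv
      rw [vo x t v hv.1 hv.2.1, hA v hv.2.2, mul_zero]
    · show suspFun a b x t c * suspFun a b x t d = 0
      by_cases hca : c = a
      · subst hca
        by_cases hd : d = b
        · subst hd; rw [hxa, hxb]; exact hmm t
        · rw [hfa d hcd hd, mul_zero]
      by_cases hcb : c = b
      · subst hcb
        by_cases hd : d = a
        · subst hd; rw [hxa, hxb, mul_comm]; exact hmm t
        · rw [hfb d hcd hd, mul_zero]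
      by_cases hda : d = a
      · subst hda; rw [hfa c hcd.symm hcb, zero_mul]
      by_cases hdb : d = b
      · subst hdb; rw [hfb c hcd.symm hca, zero_mul]
      rw [vo x t c hca hcb, vo x t d hda hdb]
      linear_combination (1 - |2 * (t : ℝ) - 1|) ^ 2 * hI c d hcd
    · simp only [suspFun]
      rw [Finset.sum_add_distrib, Finset.sum_add_distrib, ← Finset.mul_sum, ← Finset.mul_sum,
        ← Finset.mul_sum, h1]
      simp
      linarith [habs t]
  let g : indRealizationIn G A × unitInterval → indRealizationIn G S :=
    fun p => ⟨suspFun a b p.1.1 p.2, hmem p⟩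
  have hg : Continuous g := by
    refine Continuous.subtype_mk ?_ _
    have h1 : Continuous fun q : (V → ℝ) × ℝ => suspFun a b q.1 q.2 := by
      unfold suspFun
      fun_prop
    have h2 : Continuous fun p : indRealizationIn G A × unitInterval =>
        ((p.1 : V → ℝ), (p.2 : ℝ)) :=
      (continuous_subtype_val.comp continuous_fst).prodMk
        (continuous_subtype_val.comp continuous_snd)
    exact h1.comp h2
  have hcompat : ∀ p q : indRealizationIn G A × unitInterval,
      ((p.2 = 0 ∧ q.2 = 0) ∨ (p.2 = 1 ∧ q.2 = 1)) → g p = g q := by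
    rintro ⟨x, t⟩ ⟨y, s⟩ (⟨h1, h2⟩ | ⟨h1, h2⟩) <;> simp only at h1 h2 <;> subst h1 h2 <;>
      apply Subtype.ext <;> funext v <;> simp [g, suspFun] <;> norm_num
  let F : Susp (indRealizationIn G A) → indRealizationIn G S := Quot.lift g hcompat
  have hF : Continuous F := continuous_quot_lift hcompat hg
  have hinj : Function.Injective F := by
    intro p q
    refine Quot.induction_on₂ p q ?_
    rintro ⟨⟨x, hx⟩, t⟩ ⟨⟨y, hy⟩, s⟩ h
    have h' : suspFun a b x t = suspFun a b y s := congrArg Subtype.val h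
    have h1 := congrFun h' a
    have h2 := congrFun h' b
    rw [va x hx, va y hy] at h1
    rw [vb x hx, vb y hy] at h2
    have hdiff : ∀ t : ℝ, max 0 (2 * t - 1) - max 0 (1 - 2 * t) = 2 * t - 1 := by
      intro t
      rcases le_total (2 * t) 1 with h | h
      · rw [max_eq_left (by linarith), max_eq_right (by linarith)]; ring
      · rw [max_eq_right (by linarith), max_eq_left (by linarith)]; ring
    have hts : t = s := by
      apply Subtype.ext
      have := hdiff t; have := hdiff s; linarith
    subst hts
    by_cases hz : 1 - |2 * (t : ℝ) - 1| = 0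
    · apply Quot.sound
      have : |2 * (t : ℝ) - 1| = 1 := by linarith
      rcases (abs_eq zero_le_one).1 this with h | h
      · right
        have : t = 1 := Subtype.ext (by show (t : ℝ) = 1; linarith)
        exact ⟨this, this⟩
      · left
        have : t = 0 := Subtype.ext (by show (t : ℝ) = 0; linarith)
        exact ⟨this, this⟩
    · have : x = y := by
        funext v
        by_cases hva : v = a
        · subst hva; rw [xa x hx, xa y hy]
        by_cases hvb : v = b
        · subst hvb; rw [xb x hx, xb y hy]
        have := congrFun h' v
        rw [vo x t v hva hvb, vo y t v hva hvb] at this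
        exact mul_left_cancel₀ hz this
      subst this
      rfl
  have hsurj : Function.Surjective F := by
    rintro ⟨f, hf⟩
    obtain ⟨h0, hA, hI, h1⟩ := (mem_ind_iff _ _ _).1 hf
    have hfab := hI a b hab
    -- the complementary mass
    have hsum : ∑ v, (if v = a then 0 else if v = b then 0 else f v) = 1 - f a - f b := by
      have : ∀ v, (if v = a then 0 else if v = b then 0 else f v) =
          f v - (if v = a then f a else 0) - (if v = b then f b else 0) := by
        intro v
        by_cases hva : v = a
        · subst hva; simp [hne']
        · by_cases hvb : v = b
          · subst hvb; simp [hva]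
          · simp [hva, hvb]
      rw [Finset.sum_congr rfl (fun v _ => this v), Finset.sum_sub_distrib,
        Finset.sum_sub_distrib, h1]
      simp
    have hnn : ∀ v, 0 ≤ (if v = a then 0 else if v = b then 0 else f v) := by
      intro v; split_ifs <;> simp [h0]
    have hm0 : 0 ≤ 1 - f a - f b := by
      rw [← hsum]; exact Finset.sum_nonneg fun v _ => hnn v
    have ha0 := h0 a
    have hb0 := h0 b
    let t : unitInterval := ⟨(1 + f b - f a) / 2, by constructor <;> linarith⟩
    have ht : 2 * (t : ℝ) - 1 = f b - f a := by simp [t]; ring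
    have ht' : 1 - 2 * (t : ℝ) = f a - f b := by linarith
    have hma : max 0 (1 - 2 * (t : ℝ)) = f a := by
      rw [ht']
      rcases mul_eq_zero.1 hfab with h | h
      · rw [h]; simpa using hb0
      · rw [h]; simpa using ha0
    have hmb : max 0 (2 * (t : ℝ) - 1) = f b := by
      rw [ht]
      rcases mul_eq_zero.1 hfab with h | h
      · rw [h]; simpa using hb0
      · rw [h]; simpa using ha0
    have hc : 1 - |2 * (t : ℝ) - 1| = 1 - f a - f b := by rw [habs, hma, hmb]; ring
    suffices hx : ∃ x ∈ indRealizationIn G A, ∀ v, v ≠ a → v ≠ b → (1 - f a - f b) * x v = f v by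
      obtain ⟨x, hx, hxv⟩ := hx
      refine ⟨Quot.mk _ (⟨x, hx⟩, t), ?_⟩
      apply Subtype.ext
      funext v
      show suspFun a b x t v = f v
      by_cases hva : v = a
      · subst hva; rw [va x hx, hma]
      by_cases hvb : v = b
      · subst hvb; rw [vb x hx, hmb]
      rw [vo x t v hva hvb, hc, hxv v hva hvb]
    by_cases hz : 1 - f a - f b = 0
    · obtain ⟨c, hcA⟩ := hne
      refine ⟨Pi.single c 1, ?_, fun v hva hvb => ?_⟩
      · rw [mem_ind_iff]
        refine ⟨fun v => ?_, fun v hv => ?_, fun d e hde => ?_, by simp⟩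
        · simp only [Pi.single_apply]; split_ifs <;> simp
        · have : v ≠ c := by rintro rfl; exact hv hcA
          simp [this]
        · have := hde.ne
          simp only [Pi.single_apply]; split_ifs <;> simp_all
      · rw [hz, zero_mul]
        rw [hz] at hsum
        have := (Finset.sum_eq_zero_iff_of_nonneg (fun v _ => hnn v)).1 hsum v (Finset.mem_univ v)
        simpa [hva, hvb] using this.symm
    · have hpos : 0 < 1 - f a - f b := lt_of_le_of_ne hm0 (Ne.symm hz)
      refine ⟨fun v => (if v = a then 0 else if v = b then 0 else f v) / (1 - f a - f b), ?_, ?_⟩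
      · rw [mem_ind_iff]
        refine ⟨fun v => div_nonneg (hnn v) hm0, fun v hv => ?_, fun d e hde => ?_, ?_⟩
        · by_cases hva : v = a
          · simp [hva]
          by_cases hvb : v = b
          · simp [hvb]
          have : v ∉ S := by subst hS; simp [hva, hvb, hv]
          simp [hA v this]
        · have := hI d e hde
          rw [div_mul_div_comm]
          have h2 : (if d = a then 0 else if d = b then 0 else f d) *
            (if e = a then 0 else if e = b then 0 else f e) = 0 := by
            split_ifs <;> simp [mul_eq_zero.1 this]
          rw [h2, zero_div]
        · rw [← Finset.sum_div, hsum, div_self hz]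
      · intro v hva hvb
        simp only [hva, hvb, if_false]
        field_simp
  have := ind_compact G A
  have : CompactSpace (Susp (indRealizationIn G A)) :=
    inferInstanceAs (CompactSpace (Quot _))
  exact ⟨Continuous.homeoOfEquivCompactToT2 (f := Equiv.ofBijective F ⟨hinj, hsurj⟩) hF⟩

/-- functoriality of the suspension -/
def suspMap {X Y : Type*} [TopologicalSpace X] [TopologicalSpace Y] (f : X → Y) :
    Susp X → Susp Y :=
  Quot.map (fun p => (f p.1, p.2)) (fun _ _ h => h)

theorem suspMap_cont {X Y : Type*} [TopologicalSpace X] [TopologicalSpace Y] (f : X → Y)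
    (hf : Continuous f) : Continuous (suspMap f) := by
  refine continuous_quot_lift _ ?_
  exact continuous_quot_mk.comp (by fun_prop)

def suspCongr {X Y : Type*} [TopologicalSpace X] [TopologicalSpace Y] (e : X ≃ₜ Y) :
    Susp X ≃ₜ Susp Y where
  toFun := suspMap e
  invFun := suspMap e.symm
  left_inv := by
    intro p
    refine Quot.induction_on p ?_
    rintro ⟨x, t⟩
    simp [suspMap, Quot.map]
    rfl
  right_inv := by
    intro p
    refine Quot.induction_on p ?_
    rintro ⟨x, t⟩
    simp [suspMap, Quot.map]
    rfl
  continuous_toFun := suspMap_cont _ e.continuous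
  continuous_invFun := suspMap_cont _ e.symm.continuous

theorem ind_reindex {V W : Type*} [Fintype V] [Fintype W] (G : SimpleGraph V) (H : SimpleGraph W)
    (A : Set V) (B : Set W) (φ : V → W) (hφ : Function.Injective φ)
    (hadj : ∀ x y, H.Adj (φ x) (φ y) ↔ G.Adj x y)
    (hAB : ∀ x, φ x ∈ B ↔ x ∈ A) (hB : ∀ y ∈ B, ∃ x, φ x = y) :
    Nonempty (indRealizationIn H B ≃ₜ indRealizationIn G A) := by
  have hsum : ∀ f : W → ℝ, (∀ v, v ∉ B → f v = 0) → ∑ x, f (φ x) = ∑ y, f y := by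
    intro f hf
    refine Finset.sum_of_injOn φ hφ.injOn (by simp) ?_ (by simp)
    intro y _ hy
    apply hf
    intro hyB
    obtain ⟨x, hx⟩ := hB y hyB
    exact hy ⟨x, by simp, hx⟩
  let F : indRealizationIn H B → indRealizationIn G A := fun f => ⟨fun x => f.1 (φ x), by
    obtain ⟨h0, hA, hI, h1⟩ := (mem_ind_iff _ _ _).1 f.2
    rw [mem_ind_iff]
    exact ⟨fun v => h0 _, fun v hv => hA _ (fun h => hv ((hAB v).1 h)),
      fun a b hab => hI _ _ ((hadj a b).2 hab), by rw [hsum _ hA, h1]⟩⟩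
  have hF : Continuous F := by
    refine Continuous.subtype_mk ?_ _
    exact continuous_pi fun x => (continuous_apply (φ x)).comp continuous_subtype_val
  have hinj : Function.Injective F := by
    intro f g h
    have h' : (fun x => f.1 (φ x)) = fun x => g.1 (φ x) := congrArg Subtype.val h
    apply Subtype.ext
    funext y
    by_cases hy : y ∈ B
    · obtain ⟨x, rfl⟩ := hB y hy
      exact congrFun h' x
    · rw [((mem_ind_iff _ _ _).1 f.2).2.1 y hy, ((mem_ind_iff _ _ _).1 g.2).2.1 y hy]
  have hsurj : Function.Surjective F := by
    rintro ⟨f, hf⟩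
    obtain ⟨h0, hA, hI, h1⟩ := (mem_ind_iff _ _ _).1 hf
    have hex : ∀ x, Function.extend φ f 0 (φ x) = f x := fun x => hφ.extend_apply _ _ _
    have hnex : ∀ y, (¬ ∃ x, φ x = y) → Function.extend φ f 0 y = 0 := fun y hy => by
      rw [Function.extend_apply' _ _ _ hy]; rfl
    have hz : ∀ y, y ∉ B → Function.extend φ f 0 y = 0 := by
      intro y hy
      by_cases h : ∃ x, φ x = y
      · obtain ⟨x, rfl⟩ := h
        rw [hex, hA x (fun h => hy ((hAB x).2 h))]
      · exact hnex y h
    refine ⟨⟨Function.extend φ f 0, ?_⟩, Subtype.ext (funext hex)⟩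
    rw [mem_ind_iff]
    refine ⟨fun y => ?_, hz, fun c d hcd => ?_, ?_⟩
    · by_cases h : ∃ x, φ x = y
      · obtain ⟨x, rfl⟩ := h
        rw [hex]; exact h0 x
      · rw [hnex y h]
    · by_cases h : ∃ x, φ x = c
      · obtain ⟨x, rfl⟩ := h
        by_cases h' : ∃ x, φ x = d
        · obtain ⟨z, rfl⟩ := h'
          rw [hex, hex]; exact hI _ _ ((hadj _ _).1 hcd)
        · rw [hnex d h', mul_zero]
      · rw [hnex c h, zero_mul]
    · rw [← hsum _ hz, ← h1]
      exact Finset.sum_congr rfl fun x _ => hex x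
  have := ind_compact H B
  exact ⟨Continuous.homeoOfEquivCompactToT2 (f := Equiv.ofBijective F ⟨hinj, hsurj⟩) hF⟩

theorem hexRow_adj (n : ℕ) (p q : Fin 2 × Fin (2 * n + 1)) :
    (hexRow n).Adj p q ↔
      (p.1.val = q.1.val ∧ (p.2.val + 1 = q.2.val ∨ q.2.val + 1 = p.2.val)) ∨
      (p.1.val ≠ q.1.val ∧ p.2.val = q.2.val ∧ p.2.val % 2 = 0) := by
  obtain ⟨p1, p2⟩ := p
  obtain ⟨q1, q2⟩ := q
  simp only [hexRow, SimpleGraph.fromRel_adj, ne_eq, Prod.mk.injEq, Fin.ext_iff]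
  omega

/-- the vertex of `H_{1×1×n}` in row `j`, column `i` -/
def hv (n j i : ℕ) (hj : j < 2) (hi : i < 2 * n + 1) : Fin 2 × Fin (2 * n + 1) :=
  (⟨j, hj⟩, ⟨i, hi⟩)

theorem hv_eq (n : ℕ) (p : Fin 2 × Fin (2 * n + 1)) (j i : ℕ) (hj : j < 2) (hi : i < 2 * n + 1) :
    p = hv n j i hj hi ↔ p.1.val = j ∧ p.2.val = i := by
  obtain ⟨p1, p2⟩ := p
  simp [hv, Fin.ext_iff]

end Helpers

/-- for `n ≥ 2`, `Ind (X_n^{(1)}) ≃ Σ² (Ind (X_{n-1}^{(2)}))`. -/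
theorem ind_Xn1_susp (n : ℕ) (hn : 2 ≤ n) :
    Nonempty (ContinuousMap.HomotopyEquiv (↥(Xn1 n))
      (Susp (Susp (↥(Xn2 (n - 1)))))) := by
  obtain ⟨m, rfl⟩ : ∃ m, n = m + 1 := ⟨n - 1, by omega⟩
  have hm : 1 ≤ m := by omega
  show Nonempty (ContinuousMap.HomotopyEquiv (↥(Xn1 (m + 1))) (Susp (Susp (↥(Xn2 m)))))
  -- membership in the starting vertex set
  have hS0 : ∀ p : Fin 2 × Fin (2 * (m + 1) + 1), p ∈ ({hexTop (m + 1)}ᶜ : Set _) ↔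
      ¬ (p.1.val = 0 ∧ p.2.val = 2 * m + 2) := by
    intro p
    have := hv_eq (m + 1) p 0 (2 * m + 2) (by omega) (by omega)
    rw [← this]; rfl
  let u1 := hv (m + 1) 0 (2 * m - 1) (by omega) (by omega)
  let u2 := hv (m + 1) 1 (2 * m) (by omega) (by omega)
  let w := hv (m + 1) 0 (2 * m + 1) (by omega) (by omega)
  let w' := hv (m + 1) 0 (2 * m) (by omega) (by omega)
  let c := hv (m + 1) 1 (2 * m + 1) (by omega) (by omega)
  let d := hv (m + 1) 1 (2 * m + 2) (by omega) (by omega)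
  let A : Set (Fin 2 × Fin (2 * (m + 1) + 1)) :=
    {p | (p.1.val = 0 ∧ p.2.val < 2 * m - 1) ∨ (p.1.val = 1 ∧ p.2.val < 2 * m)}
  have e1 := ind_fold (hexRow (m + 1)) ({hexTop (m + 1)}ᶜ) u1 w
    (by rw [hS0]; simp [w, hv]) (by intro h; simp [u1, w, hv] at h; try omega)
    (by rw [hexRow_adj]; simp only [u1, w, hv]; omega)
    (by intro x hx; rw [hS0] at hx; simp only [hexRow_adj, u1, w, hv]; omega)
  have e2 := ind_fold (hexRow (m + 1)) ({hexTop (m + 1)}ᶜ \ {u1}) u2 w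
    (by rw [Set.mem_sdiff, hS0]; simp [u1, w, hv]; omega) (by simp [u2, w, hv])
    (by rw [hexRow_adj]; simp [u2, w, hv])
    (by
      intro x hx; rw [Set.mem_sdiff, hS0] at hx; have := x.1.2
      simp only [hexRow_adj, u2, w, hv]; omega)
  have e3 := susp_homeo (hexRow (m + 1)) (insert c (insert d A)) (({hexTop (m + 1)}ᶜ \ {u1}) \ {u2})
    w' w
    (by
      ext p
      have := p.1.2
      have := p.2.2
      simp only [Set.mem_sdiff, hS0, Set.mem_insert_iff, Set.mem_singleton_iff, u1, u2, w, w', c, d,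
        hv_eq, A, Set.mem_ofPred_eq]
      omega)
    (by rw [hexRow_adj]; simp [w, w', hv])
    (by simp only [Set.mem_insert_iff, c, d, hv_eq, A, Set.mem_ofPred_eq]; simp [w', hv])
    (by simp only [Set.mem_insert_iff, c, d, hv_eq, A, Set.mem_ofPred_eq]; simp [w, hv]; omega)
    (by
      intro x
      simp only [Set.mem_insert_iff, c, d, hv_eq, A, Set.mem_ofPred_eq, hexRow_adj]
      simp only [w', hv]; omega)
    (by
      intro x
      simp only [Set.mem_insert_iff, c, d, hv_eq, A, Set.mem_ofPred_eq, hexRow_adj]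
      simp only [w, hv]; omega)
    ⟨c, by simp⟩
  have e4 := susp_homeo (hexRow (m + 1)) A (insert c (insert d A)) c d rfl
    (by rw [hexRow_adj]; simp [c, d, hv])
    (by simp [A, c, hv]) (by simp [A, d, hv])
    (by intro x; simp only [A, Set.mem_ofPred_eq, hexRow_adj, c, hv]; omega)
    (by intro x; simp only [A, Set.mem_ofPred_eq, hexRow_adj, d, hv]; omega)
    ⟨hv (m + 1) 1 0 (by omega) (by omega), by simp [A, hv]; omega⟩
  have e5 := ind_reindex (hexRow m) (hexRow (m + 1))
    ((insert (hexTop m) ((hexRow m).neighborSet (hexTop m)))ᶜ) A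
    (fun p => (p.1, ⟨p.2.val, by omega⟩))
    (by
      rintro ⟨p1, p2⟩ ⟨q1, q2⟩ h
      simp [Fin.ext_iff] at h ⊢
      exact h)
    (by intro x y; simp only [hexRow_adj])
    (by
      intro x
      have h1 := x.1.2
      have h2 := x.2.2
      have := hv_eq m x 0 (2 * m) (by omega) (by omega)
      have h3 : x = hexTop m ↔ _ := this
      simp only [A, Set.mem_ofPred_eq, Set.mem_compl_iff, Set.mem_insert_iff,
        SimpleGraph.mem_neighborSet, h3, hexRow_adj]
      simp only [hexTop, Fin.val_zero]
      omega)
    (by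
      rintro ⟨p1, p2⟩ hp
      simp only [A, Set.mem_ofPred_eq] at hp
      exact ⟨(p1, ⟨p2.val, by omega⟩), rfl⟩)
  obtain ⟨e1⟩ := e1
  obtain ⟨e2⟩ := e2
  obtain ⟨e3⟩ := e3
  obtain ⟨e4⟩ := e4
  obtain ⟨e5⟩ := e5
  exact ⟨(e1.trans e2).trans
    ((e3.symm.trans (suspCongr (e4.symm.trans (suspCongr e5)))).toHomotopyEquiv)⟩
end
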